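/- arXiv:2212.09341 — 2 statements merged into one kernel-verified Lean document; each statement's English description precedes it below -/
import Mathlib

section
/- Let p be a prime such that S is p-maximal, and let λ = (l,μ,m) ∈ L₀^# ∩ P_S with ν_λ := ν_p(gcd(S₀λ)) = ν_p(m). Then for every integer ν ≥ 0: Σ_{j=0}^{ν} p^{(ν−j)·n} · b(λ, p^j) = p^ν · N*(λ, p^ν). -/
open Matrix Complex

namespace OEis

/-- Extension of an even Gram matrix by a hyperbolic plane:
`[[0,0,1],[0,A,0],[1,0,0]]`. -/
def hyp {m : ℕ} (A : Matrix (Fin m) (Fin m) ℤ) :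
    Matrix (Fin (m + 2)) (Fin (m + 2)) ℤ := fun i j =>
  if hi0 : (i : ℕ) = 0 then (if (j : ℕ) = m + 1 then 1 else 0)
  else if him : (i : ℕ) = m + 1 then (if (j : ℕ) = 0 then 1 else 0)
  else if hj0 : (j : ℕ) = 0 then 0
  else if hjm : (j : ℕ) = m + 1 then 0
  else A ⟨(i : ℕ) - 1, by have := i.isLt; omega⟩ ⟨(j : ℕ) - 1, by have := j.isLt; omega⟩

variable (n : ℕ) (S : Matrix (Fin n) (Fin n) ℤ)

/-- `S₀ = [[0,0,1],[0,-S,0],[1,0,0]]`. -/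
def MatS0 : Matrix (Fin (n + 2)) (Fin (n + 2)) ℤ := hyp (-S)

/-- `S₁ = [[0,0,1],[0,S₀,0],[1,0,0]]`. -/
def MatS1 : Matrix (Fin (n + 4)) (Fin (n + 4)) ℤ := hyp (MatS0 n S)

/-- Bilinear form `uᵀ A v` over a field `K`. -/
def bilin {m : ℕ} (K : Type) [Field K] (A : Matrix (Fin m) (Fin m) ℤ)
    (u v : Fin m → K) : K :=
  u ⬝ᵥ (A.map (Int.cast : ℤ → K)).mulVec v

/-- Quadratic form `Q_A(v) = vᵀAv/2` over a field `K`. -/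
def quadF {m : ℕ} (K : Type) [Field K] (A : Matrix (Fin m) (Fin m) ℤ)
    (v : Fin m → K) : K := bilin K A v v / 2

/-- First component of a vector. -/
def vfirst {m : ℕ} {K : Type} (g : Fin (m + 2) → K) : K := g ⟨0, by omega⟩

/-- Last component of a vector. -/
def vlast {m : ℕ} {K : Type} (g : Fin (m + 2) → K) : K := g ⟨m + 1, by omega⟩

/-- Middle components of a vector. -/
def vmid {m : ℕ} {K : Type} (g : Fin (m + 2) → K) : Fin m → K :=
  fun i => g ⟨(i : ℕ) + 1, by have := i.isLt; omega⟩

/-- gcd of the entries of a rational vector (via numerators). -/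
def ratGcd {m : ℕ} (v : Fin m → ℚ) : ℕ :=
  Finset.gcd Finset.univ fun i => (v i).num.natAbs

/-- `v` has integral entries. -/
def inLat {m : ℕ} (v : Fin m → ℚ) : Prop := ∀ i, ∃ z : ℤ, v i = (z : ℚ)

/-- `g ∈ ℤ^m + c`. -/
def inLatShift {m : ℕ} (c g : Fin m → ℚ) : Prop := ∀ i, ∃ z : ℤ, g i - c i = (z : ℚ)

/-- Membership in the dual lattice `A⁻¹ℤ^m`, i.e. `Av` is integral. -/
def inDual {m : ℕ} (A : Matrix (Fin m) (Fin m) ℤ) (v : Fin m → ℚ) : Prop :=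
  ∀ i, ∃ z : ℤ, ((A.map (Int.cast : ℤ → ℚ)).mulVec v) i = (z : ℚ)

/-- The positive cone `P_S`. -/
def PosCone : Set (Fin (n + 2) → ℝ) :=
  {y | 0 < quadF ℝ (MatS0 n S) y ∧ 0 < y ⟨0, by omega⟩}

/-- The tube domain `H_S`. -/
def HS : Set (Fin (n + 2) → ℂ) :=
  {z | (fun i => (z i).im) ∈ PosCone n S}

/-- Automorphy factor attached to a vector:
`j(g,z) = -γ Q₀(z) + (d,z)₀ + δ` for `g = (δ,dᵀ,γ)ᵀ`. -/
noncomputable def jay (g : Fin (n + 4) → ℚ) (z : Fin (n + 2) → ℂ) : ℂ :=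
  -((vlast g : ℚ) : ℂ) * quadF ℂ (MatS0 n S) z
    + bilin ℂ (MatS0 n S) (fun i => ((vmid g i : ℚ) : ℂ)) z
    + ((vfirst g : ℚ) : ℂ)

/-- The index set of the Eisenstein series attached to a cusp `c`:
`{g ∈ L₁ + c : Q₁(g) = 0, gcd(S₁g) = 1}`. -/
def cuspSet (c : Fin (n + 4) → ℚ) : Set (Fin (n + 4) → ℚ) :=
  {g | inLatShift c g ∧ quadF ℚ (MatS1 n S) g = 0 ∧
    ratGcd (((MatS1 n S).map (Int.cast : ℤ → ℚ)).mulVec g) = 1}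

/-- The standard-form cusp vector `(1, 0, 𝔠ᵀ, 0, Q(𝔠))ᵀ`. -/
def stdCuspVec (fc : Fin n → ℚ) : Fin (n + 4) → ℚ := fun i =>
  if h0 : (i : ℕ) = 0 then 1
  else if h3 : (i : ℕ) = n + 3 then quadF ℚ S fc
  else if h12 : (i : ℕ) = 1 ∨ (i : ℕ) = n + 2 then 0
  else fc ⟨(i : ℕ) - 2, by have := i.isLt; omega⟩

/-- `c` is a standard-form cusp. -/
def IsStdCusp (c : Fin (n + 4) → ℚ) : Prop :=
  ∃ fc : Fin n → ℚ, inDual S fc ∧ (∃ z : ℤ, quadF ℚ S fc = (z : ℚ)) ∧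
    c = stdCuspVec n S fc

/-- The real orthogonal group of `A`. -/
def OSet {m : ℕ} (A : Matrix (Fin m) (Fin m) ℤ) : Set (Matrix (Fin m) (Fin m) ℝ) :=
  {M | Mᵀ * A.map (Int.cast : ℤ → ℝ) * M = A.map (Int.cast : ℤ → ℝ)}

/-- Connected component of the identity in the real orthogonal group. -/
def OPlus {m : ℕ} (A : Matrix (Fin m) (Fin m) ℤ) : Set (Matrix (Fin m) (Fin m) ℝ) :=
  connectedComponentIn (OSet A) 1

/-- `Γ_S`: integral matrices in `O⁺(S₁;ℝ)`. -/
def GammaS : Set (Matrix (Fin (n + 4)) (Fin (n + 4)) ℝ) :=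
  {M | M ∈ OPlus (MatS1 n S) ∧ ∀ i j, ∃ z : ℤ, M i j = (z : ℝ)}

/-- The discriminant kernel `Γ̃_S`. -/
def GammaTilde : Set (Matrix (Fin (n + 4)) (Fin (n + 4)) ℝ) :=
  {M | M ∈ GammaS n S ∧
    ∃ X : Matrix (Fin (n + 4)) (Fin (n + 4)) ℤ,
      M = 1 + (X * MatS1 n S).map (Int.cast : ℤ → ℝ)}

/-- Automorphy factor of a matrix: `j(M,z) = -γ Q₀(z) + (d,z)₀ + δ`
where `(γ, dᵀS₀, δ)` is the bottom row of `M`. -/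
noncomputable def jayM (M : Matrix (Fin (n + 4)) (Fin (n + 4)) ℝ)
    (z : Fin (n + 2) → ℂ) : ℂ :=
  -((M ⟨n + 3, by omega⟩ ⟨0, by omega⟩ : ℝ) : ℂ) * quadF ℂ (MatS0 n S) z
    + ∑ i : Fin (n + 2),
        ((M ⟨n + 3, by omega⟩ ⟨(i : ℕ) + 1, by have := i.isLt; omega⟩ : ℝ) : ℂ) * z i
    + ((M ⟨n + 3, by omega⟩ ⟨n + 3, by omega⟩ : ℝ) : ℂ)

/-- The action `M⟨z⟩ = (-Q₀(z)·b + Kz + c')·j(M,z)⁻¹`. -/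
noncomputable def actM (M : Matrix (Fin (n + 4)) (Fin (n + 4)) ℝ)
    (z : Fin (n + 2) → ℂ) : Fin (n + 2) → ℂ := fun i =>
  (-(quadF ℂ (MatS0 n S) z) *
      ((M ⟨(i : ℕ) + 1, by have := i.isLt; omega⟩ ⟨0, by omega⟩ : ℝ) : ℂ)
    + ∑ j : Fin (n + 2),
        ((M ⟨(i : ℕ) + 1, by have := i.isLt; omega⟩
            ⟨(j : ℕ) + 1, by have := j.isLt; omega⟩ : ℝ) : ℂ) * z j
    + ((M ⟨(i : ℕ) + 1, by have := i.isLt; omega⟩ ⟨n + 3, by omega⟩ : ℝ) : ℂ))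
  * (jayM n S M z)⁻¹

/-- The integral vector `(−Q₀(d)/γ, dᵀ, γ)ᵀ` built from `d` and `γ`. -/
def gExt (d : Fin (n + 2) → ℕ) (γ : ℕ) : Fin (n + 4) → ℚ := fun i =>
  if h0 : (i : ℕ) = 0 then -(quadF ℚ (MatS0 n S) fun j => (d j : ℚ)) / γ
  else if h3 : (i : ℕ) = n + 3 then (γ : ℚ)
  else (d ⟨(i : ℕ) - 1, by have := i.isLt; omega⟩ : ℚ)

open scoped Classical in
/-- The Dirichlet coefficient `a(λ,γ)`. -/
noncomputable def aCoef (lam : Fin (n + 2) → ℚ) (γ : ℕ) : ℂ :=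
  ∑ d ∈ Fintype.piFinset fun _ : Fin (n + 2) => Finset.range γ,
    if (∃ e : ℤ, quadF ℚ (MatS0 n S) (fun j => (d j : ℚ)) = (γ : ℚ) * e) ∧
        ratGcd (((MatS1 n S).map (Int.cast : ℤ → ℚ)).mulVec (gExt n S d γ)) = 1 then
      Complex.exp (2 * Real.pi * Complex.I *
        ((bilin ℚ (MatS0 n S) lam (fun j => (d j : ℚ)) / γ : ℚ) : ℂ))
    else 0

/-- The convolution `b(λ,γ) = Σ_{δ∣γ} a(λ,δ)`. -/
noncomputable def bCoef (lam : Fin (n + 2) → ℚ) (γ : ℕ) : ℂ :=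
  ∑ δ ∈ γ.divisors, aCoef n S lam δ

/-- The order/level of a rational vector: least `N ≥ 1` with `Nv` integral. -/
noncomputable def ordv {m : ℕ} (v : Fin m → ℚ) : ℕ :=
  sInf {N : ℕ | 0 < N ∧ ∀ i, ∃ z : ℤ, (N : ℚ) * v i = (z : ℚ)}

/-- `S` is `p`-maximal. -/
def pMaximal (p : ℕ) : Prop :=
  ∀ v : Fin n → ℚ, inDual S v → (∃ z : ℤ, quadF ℚ S v = (z : ℚ)) → ¬ p ∣ ordv v

/-- The vector `(l, μᵀ, m)ᵀ ∈ ℚ^{n+2}`. -/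
def asmVec (l : ℚ) (μ : Fin n → ℚ) (m : ℚ) : Fin (n + 2) → ℚ := fun i =>
  if h0 : (i : ℕ) = 0 then l
  else if h1 : (i : ℕ) = n + 1 then m
  else μ ⟨(i : ℕ) - 1, by have := i.isLt; omega⟩

open scoped Classical in
/-- The representation number `N(λ, p^ν, p^t)`. -/
noncomputable def Ncount (lam : Fin (n + 2) → ℚ) (p νl ν t : ℕ) : ℕ :=
  ((Fintype.piFinset fun _ : Fin n => Finset.range (p ^ ν)).filter fun v =>
    (∃ e : ℤ, quadF ℚ S (fun i => (v i : ℚ)) = (p : ℚ) ^ (t : ℕ) * e) ∧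
    (∃ e : ℤ, (p : ℚ) ^ ((νl : ℤ) - (t : ℤ)) * quadF ℚ S (fun i => (v i : ℚ))
        - bilin ℚ S (fun i => (v i : ℚ)) (vmid lam)
        + (p : ℚ) ^ ((t : ℤ) - (νl : ℤ)) * lam ⟨0, by omega⟩ * lam ⟨n + 1, by omega⟩
      = (p : ℚ) ^ (ν : ℕ) * e)).card

/-- `N*(λ,p^ν) = Σ_{t=0}^{min(ν,ν_λ)} N(λ,p^ν,p^t)`. -/
noncomputable def Nstar (lam : Fin (n + 2) → ℚ) (p νl ν : ℕ) : ℕ :=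
  ∑ t ∈ Finset.range (min ν νl + 1), Ncount n S lam p νl ν t

/-- Kloosterman sum `K(α,β;γ)` (with `β` allowed rational;
in all uses `β` is an integer). -/
noncomputable def kloos (α : ℤ) (β : ℚ) (γ : ℕ) : ℂ :=
  ∑ j ∈ Finset.range γ,
    if Nat.Coprime j γ then
      Complex.exp (2 * Real.pi * Complex.I *
        ((((α : ℚ) * j + β * ((((j : ZMod γ)⁻¹).val : ℕ) : ℚ)) / γ : ℚ) : ℂ))
    else 0

/-- `q ≡ 0 (mod p^k)` in `ℤ_p`, for a rational `q`. -/
def pCong (p k : ℕ) (q : ℚ) : Prop :=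
  q = 0 ∨ (k : ℤ) ≤ padicValRat p q

/-- The constant `c_{k,S}^• = (2π)^{2k-n/2}/(√(det S)·Γ(k)·Γ(k-n/2))`. -/
noncomputable def ckS (k : ℕ) : ℝ :=
  (2 * Real.pi) ^ ((2 * k : ℝ) - n / 2) /
    (Real.sqrt ((S.det : ℤ) : ℝ) * Real.Gamma (k : ℝ) * Real.Gamma ((k : ℝ) - n / 2))

end OEis

open OEis

namespace PrimePowerSums

/-- Summing a function over the image of a surjective homomorphism of finite groups. -/
lemma card_mul_sum_comp {G H : Type*} [AddCommGroup G] [Fintype G] [AddCommGroup H] [Fintype H]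
    (φ : G →+ H) (hφ : Function.Surjective φ) (F : H → ℂ) :
    (Fintype.card H : ℂ) * ∑ g, F (φ g) = (Fintype.card G : ℂ) * ∑ h, F h := by
  have h1 : ∀ h : H, ∑ g, F (φ g) = ∑ g, F (φ g + h) := by
    intro h
    obtain ⟨g₀, rfl⟩ := hφ h
    simp_rw [← map_add]
    exact (Equiv.sum_comp (Equiv.addRight g₀) fun g => F (φ g)).symm
  have h2 : ∀ g : G, ∑ h, F (φ g + h) = ∑ h, F h := fun g =>
    Equiv.sum_comp (Equiv.addLeft (φ g)) F
  calc (Fintype.card H : ℂ) * ∑ g, F (φ g) = ∑ h : H, ∑ g, F (φ g + h) := by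
        rw [Finset.sum_congr rfl fun h _ => (h1 h).symm]
        simp
    _ = (Fintype.card G : ℂ) * ∑ h, F h := by
        rw [Finset.sum_comm, Finset.sum_congr rfl fun g _ => h2 g]
        simp

lemma sum_units_eq {R : Type*} [CommRing R] [Fintype R] [DecidableEq R]
    [DecidablePred (IsUnit : R → Prop)] (F : R → ℂ) :
    ∑ u : Rˣ, F u = ∑ x : R, if IsUnit x then F x else 0 := by
  rw [← Finset.sum_filter]
  refine Finset.sum_bij (fun u _ => (u : R)) ?_ ?_ ?_ ?_
  · intro u _; simp
  · intro u _ v _ h; exact Units.ext h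
  · intro x hx
    obtain ⟨u, rfl⟩ := (Finset.mem_filter.1 hx).2
    exact ⟨u, Finset.mem_univ _, rfl⟩
  · intro u _; rfl

lemma ppow_eq_zero (p j : ℕ) : (p : ZMod (p ^ j)) ^ j = 0 := by
  rw [← Nat.cast_pow, ZMod.natCast_self]

variable {p : ℕ} [hp : Fact p.Prime]

lemma sum_stdAddChar (j : ℕ) (b : ZMod (p ^ j)) :
    ∑ x, ZMod.stdAddChar (x * b) = if b = 0 then (p : ℂ) ^ j else 0 := by
  rw [AddChar.sum_mulShift b (ZMod.isPrimitive_stdAddChar _), ZMod.card]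
  split_ifs <;> simp

lemma ppow_mul_intCast_eq_zero {i t j : ℕ} (h : i + t = j) (a : ℤ) :
    (p : ZMod (p ^ j)) ^ i * (a : ZMod (p ^ j)) = 0 ↔ ((p : ℤ) ^ t ∣ a) := by
  have hp0 : (p : ℤ) ^ i ≠ 0 := pow_ne_zero _ (by exact_mod_cast hp.out.ne_zero)
  have : (p : ZMod (p ^ j)) ^ i * (a : ZMod (p ^ j)) = (((p : ℤ) ^ i * a : ℤ) : ZMod (p ^ j)) := by
    push_cast; rfl
  rw [this, ZMod.intCast_zmod_eq_zero_iff_dvd, ← h]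
  push_cast
  rw [pow_add, mul_dvd_mul_iff_left hp0]

lemma ppow_mul_eq_zero_iff {i t j : ℕ} (h : i + t = j) (y : ZMod (p ^ j)) :
    (p : ZMod (p ^ j)) ^ i * y = 0 ↔ ∃ z, y = (p : ZMod (p ^ j)) ^ t * z := by
  constructor
  · intro hy
    obtain ⟨a, rfl⟩ := ZMod.intCast_surjective y
    obtain ⟨b, rfl⟩ := (ppow_mul_intCast_eq_zero h a).1 hy
    exact ⟨b, by push_cast; rfl⟩
  · rintro ⟨z, rfl⟩
    rw [← mul_assoc, ← pow_add, h, ppow_eq_zero, zero_mul]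

lemma not_isUnit_iff {j : ℕ} (y : ZMod (p ^ (j + 1))) :
    ¬ IsUnit y ↔ (p : ZMod (p ^ (j + 1))) ^ j * y = 0 := by
  obtain ⟨a, rfl⟩ := ZMod.intCast_surjective y
  rw [ppow_mul_intCast_eq_zero (t := 1) rfl, ZMod.coe_int_isUnit_iff_isCoprime,
    pow_one]
  push_cast
  rw [IsCoprime.pow_left_iff (Nat.succ_pos j),
    (Nat.prime_iff_prime_int.1 hp.out).irreducible.coprime_iff_not_dvd, not_not]

/-- Pushing a sum over `ℤ/p^j` forward along multiplication by `p^i`. -/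
lemma sum_ppow_mul {i t j : ℕ} (h : i + t = j) (F : ZMod (p ^ j) → ℂ) :
    ∑ c, F ((p : ZMod (p ^ j)) ^ i * c) =
      (p : ℂ) ^ i * ∑ y, if (p : ZMod (p ^ j)) ^ t * y = 0 then F y else 0 := by
  classical
  let K : AddSubgroup (ZMod (p ^ j)) := (AddMonoidHom.mulLeft ((p : ZMod (p ^ j)) ^ t)).ker
  have hmem : ∀ y, y ∈ K ↔ (p : ZMod (p ^ j)) ^ t * y = 0 := fun y => Iff.rfl
  let φ : ZMod (p ^ j) →+ K := (AddMonoidHom.mulLeft ((p : ZMod (p ^ j)) ^ i)).codRestrict K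
    (fun x => (hmem _).2 ((ppow_mul_eq_zero_iff (t := i) (by omega) _).2 ⟨x, rfl⟩))
  have hφ : Function.Surjective φ := by
    rintro ⟨y, hy⟩
    obtain ⟨z, hz⟩ := (ppow_mul_eq_zero_iff (t := i) (by omega) _).1 ((hmem y).1 hy)
    exact ⟨z, Subtype.ext hz.symm⟩
  have hcard : Fintype.card K = p ^ t := by
    have := IsAddCyclic.card_nsmulAddMonoidHom_ker (ZMod (p ^ j)) (p ^ t)
    rw [Nat.card_zmod, Nat.gcd_eq_right (pow_dvd_pow p (by omega))] at this
    rw [← this, ← Nat.card_eq_fintype_card]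
    congr!
    ext x
    simp [nsmul_eq_mul]
  have key := card_mul_sum_comp φ hφ fun y => F y
  rw [hcard, ZMod.card] at key
  have hp0 : (p : ℂ) ^ t ≠ 0 := pow_ne_zero _ (by exact_mod_cast hp.out.ne_zero)
  have e : ∑ y : K, F y = ∑ y, if (p : ZMod (p ^ j)) ^ t * y = 0 then F y else 0 := by
    rw [← Finset.sum_filter]
    exact (Finset.sum_subtype _ (fun x => by simp [hmem]) F).symm
  rw [← e]
  refine mul_left_cancel₀ hp0 ?_
  rw [← mul_assoc, ← pow_add, add_comm t i, h]
  push_cast at key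
  exact key

lemma sum_eq_unit_strata {j t : ℕ} (ht : t ≤ j) (F : ZMod (p ^ j) → ℂ) :
    ∑ y, F y = ((p : ℂ) ^ t)⁻¹ * ∑ c, F ((p : ZMod (p ^ j)) ^ t * c) +
      ∑ s ∈ Finset.range t, ((p : ℂ) ^ s)⁻¹ *
        ∑ u : (ZMod (p ^ j))ˣ, F ((p : ZMod (p ^ j)) ^ s * u) := by
  classical
  have hp0 : (p : ℂ) ≠ 0 := by exact_mod_cast hp.out.ne_zero
  let E : ℕ → ℂ := fun s => ((p : ℂ) ^ s)⁻¹ * ∑ c, F ((p : ZMod (p ^ j)) ^ s * c)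
  have hE : ∀ s ∈ Finset.range t, ((p : ℂ) ^ s)⁻¹ *
      ∑ u : (ZMod (p ^ j))ˣ, F ((p : ZMod (p ^ j)) ^ s * u) = E s - E (s + 1) := by
    intro s hs
    obtain ⟨j, rfl⟩ : ∃ i, j = i + 1 :=
      ⟨j - 1, by have := Finset.mem_range.1 hs; omega⟩
    have h1 := sum_ppow_mul (p := p) (i := 1) (t := j) (by omega)
      (fun c => F ((p : ZMod (p ^ (j + 1))) ^ s * c))
    have h2 : ∑ c, F ((p : ZMod (p ^ (j + 1))) ^ (s + 1) * c) =
        ∑ c, F ((p : ZMod (p ^ (j + 1))) ^ s * ((p : ZMod (p ^ (j + 1))) ^ 1 * c)) := by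
      simp only [pow_succ, pow_zero, one_mul, mul_assoc]
    simp only [E]
    rw [h2, h1, sum_units_eq (fun c => F ((p : ZMod (p ^ (j + 1))) ^ s * c)), pow_succ (p : ℂ) s,
      mul_inv, pow_one (p : ℂ), mul_assoc, inv_mul_cancel_left₀ hp0, ← mul_sub,
      ← Finset.sum_sub_distrib]
    refine congrArg (fun z : ℂ => ((p : ℂ) ^ s)⁻¹ * z) ?_
    refine Finset.sum_congr rfl fun y _ => ?_
    by_cases hy : IsUnit y
    · rw [if_pos hy, if_neg (fun h => (not_isUnit_iff y).2 h hy), sub_zero]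
    · rw [if_neg hy, if_pos ((not_isUnit_iff y).1 hy), sub_self]
  rw [Finset.sum_congr rfl hE, Finset.sum_range_sub']
  simp [E]

lemma sum_stdAddChar_ker {i t j : ℕ} (h : i + t = j) (N : ZMod (p ^ j)) :
    (∑ z, if (p : ZMod (p ^ j)) ^ t * z = 0 then ZMod.stdAddChar (z * N) else 0) =
      if (p : ZMod (p ^ j)) ^ i * N = 0 then (p : ℂ) ^ t else 0 := by
  have hp0 : (p : ℂ) ^ i ≠ 0 := pow_ne_zero _ (by exact_mod_cast hp.out.ne_zero)
  refine mul_left_cancel₀ hp0 ?_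
  rw [← sum_ppow_mul h fun z => (ZMod.stdAddChar (z * N) : ℂ)]
  have := sum_stdAddChar (p := p) j ((p : ZMod (p ^ j)) ^ i * N)
  rw [mul_ite, ← pow_add, h, mul_zero, ← this]
  refine Finset.sum_congr rfl fun z _ => ?_
  congr 1; ring

/-- The symmetry of `∑_{xy = N} ψ(ly + mx)` in `m` and `N`. -/
lemma sum_hyperbola_swap (j : ℕ) (l m N : ZMod (p ^ j)) :
    (∑ x, ∑ y, if x * y = N then (ZMod.stdAddChar (l * y + m * x) : ℂ) else 0) =
      ∑ x, ∑ y, if x * y = m then (ZMod.stdAddChar (l * y + N * x) : ℂ) else 0 := by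
  have hp0 : (p : ℂ) ^ j ≠ 0 := pow_ne_zero _ (by exact_mod_cast hp.out.ne_zero)
  refine mul_left_cancel₀ hp0 ?_
  have h1 : ∀ x y : ZMod (p ^ j), (p : ℂ) ^ j *
      (if x * y = N then (ZMod.stdAddChar (l * y + m * x) : ℂ) else 0) =
      ∑ c, (ZMod.stdAddChar (x * (m - c * y) + (l * y + N * c)) : ℂ) := by
    intro x y
    have := sum_stdAddChar (p := p) j (N - x * y)
    simp only [sub_eq_zero, eq_comm (a := N)] at this
    rw [mul_ite, mul_zero]
    trans (ZMod.stdAddChar (l * y + m * x) : ℂ) * (if x * y = N then (p : ℂ) ^ j else 0)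
    · split_ifs <;> ring
    · rw [← this, Finset.mul_sum]
      refine Finset.sum_congr rfl fun c _ => ?_
      rw [← AddChar.map_add_eq_mul]
      congr 1; ring
  have h2 : ∀ c y : ZMod (p ^ j), (p : ℂ) ^ j *
      (if c * y = m then (ZMod.stdAddChar (l * y + N * c) : ℂ) else 0) =
      ∑ x, (ZMod.stdAddChar (x * (m - c * y) + (l * y + N * c)) : ℂ) := by
    intro c y
    have := sum_stdAddChar (p := p) j (m - c * y)
    simp only [sub_eq_zero, eq_comm (a := m)] at this
    simp_rw [AddChar.map_add_eq_mul]
    rw [← Finset.sum_mul, this]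
    split_ifs <;> simp
  simp only [Finset.mul_sum, h1, h2]
  rw [Finset.sum_comm]
  conv_rhs => rw [Finset.sum_comm]
  exact Finset.sum_congr rfl fun y _ => Finset.sum_comm

lemma sum_hyperbola_eq (j k : ℕ) (l N : ZMod (p ^ j)) (m₁ : (ZMod (p ^ j))ˣ) :
    (∑ x, ∑ y, if x * y = (p : ZMod (p ^ j)) ^ k * m₁ then
        (ZMod.stdAddChar (l * y + N * x) : ℂ) else 0) =
      (if j ≤ k then (if N = 0 then (p : ℂ) ^ j else 0) else 0) +
      ∑ s ∈ Finset.range (min j (k + 1)),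
        if (p : ZMod (p ^ j)) ^ (j - s) * N = 0 then
          ∑ u : (ZMod (p ^ j))ˣ,
            (ZMod.stdAddChar ((u : ZMod (p ^ j)) *
                (l * (p : ZMod (p ^ j)) ^ s * (m₁ : ZMod (p ^ j))) +
              ((u⁻¹ : (ZMod (p ^ j))ˣ) : ZMod (p ^ j)) * (N * (p : ZMod (p ^ j)) ^ (k - s))) : ℂ)
        else 0 := by
  have hp0 : (p : ℂ) ≠ 0 := by exact_mod_cast hp.out.ne_zero
  rw [Finset.sum_comm, sum_eq_unit_strata (min_le_left j (k + 1))]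
  congr 1
  · split_ifs with hjk hN
    · subst hN
      have : (p : ZMod (p ^ j)) ^ k = 0 := by
        rw [← Nat.sub_add_cancel hjk, pow_add, ppow_eq_zero, mul_zero]
      rw [min_eq_left (by omega), ppow_eq_zero]
      simp [this, hp0]
    · have : (p : ZMod (p ^ j)) ^ k = 0 := by
        rw [← Nat.sub_add_cancel hjk, pow_add, ppow_eq_zero, mul_zero]
      rw [min_eq_left (by omega), ppow_eq_zero]
      have h := sum_stdAddChar (p := p) j N
      rw [if_neg hN] at h
      simp [this, mul_comm N, h]
    · rw [min_eq_right (by omega)]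
      have hne : ∀ x c : ZMod (p ^ j), x * ((p : ZMod (p ^ j)) ^ (k + 1) * c) ≠
          (p : ZMod (p ^ j)) ^ k * m₁ := by
        intro x c h
        have h0 : (p : ZMod (p ^ j)) ^ (j - 1) = 0 := by
          have h2 := congrArg (fun z => (p : ZMod (p ^ j)) ^ (j - 1 - k) * z) h
          have e1 : (p : ZMod (p ^ j)) ^ (j - 1 - k) * (x * (p ^ (k + 1) * c)) =
              p ^ j * (x * c) := by
            have hj : (p : ZMod (p ^ j)) ^ j = p ^ (j - 1 - k) * p ^ (k + 1) := by
              rw [← pow_add]; congr 1; omega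
            rw [hj]; ring
          have e2 : (p : ZMod (p ^ j)) ^ (j - 1 - k) * ((p : ZMod (p ^ j)) ^ k * m₁) =
              (p : ZMod (p ^ j)) ^ (j - 1) * m₁ := by
            have hj : (p : ZMod (p ^ j)) ^ (j - 1) = p ^ (j - 1 - k) * p ^ k := by
              rw [← pow_add]; congr 1; omega
            rw [hj, mul_assoc]
          simp only [e1, e2, ppow_eq_zero, zero_mul] at h2
          exact m₁.isUnit.mul_left_eq_zero.1 h2.symm
        have h1 := (ppow_mul_intCast_eq_zero (p := p) (i := j - 1) (t := 1) (j := j) (by omega) 1).1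
          (by simpa using h0)
        have := Int.isUnit_iff.1 (isUnit_of_dvd_one h1)
        have := hp.out.two_le
        simp at *
        omega
      simp [hne]
  · refine Finset.sum_congr rfl fun s hs => ?_
    have hs' := Finset.mem_range.1 hs
    rw [← Equiv.sum_comp (Equiv.mulRight m₁)]
    have hk : ∀ u : (ZMod (p ^ j))ˣ,
        (∑ x, if x * ((p : ZMod (p ^ j)) ^ s * ((u * m₁ : (ZMod (p ^ j))ˣ) : ZMod (p ^ j))) =
            (p : ZMod (p ^ j)) ^ k * m₁ then (ZMod.stdAddChar
              (l * ((p : ZMod (p ^ j)) ^ s * ((u * m₁ : (ZMod (p ^ j))ˣ) : ZMod (p ^ j))) +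
                N * x) : ℂ) else 0) =
        (if (p : ZMod (p ^ j)) ^ (j - s) * N = 0 then (p : ℂ) ^ s else 0) *
          (ZMod.stdAddChar ((u : ZMod (p ^ j)) * (l * (p : ZMod (p ^ j)) ^ s * (m₁ : ZMod (p ^ j))) +
            ((u⁻¹ : (ZMod (p ^ j))ˣ) : ZMod (p ^ j)) * (N * (p : ZMod (p ^ j)) ^ (k - s))) : ℂ) := by
      intro u
      rw [← sum_stdAddChar_ker (p := p) (t := s) (by omega), Finset.sum_mul]
      rw [← Equiv.sum_comp (Equiv.addRight
        (((u⁻¹ : (ZMod (p ^ j))ˣ) : ZMod (p ^ j)) * (p : ZMod (p ^ j)) ^ (k - s)))]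
      refine Finset.sum_congr rfl fun z _ => ?_
      have hu : ((u⁻¹ : (ZMod (p ^ j))ˣ) : ZMod (p ^ j)) * u = 1 := u.inv_mul
      have hpk : (p : ZMod (p ^ j)) ^ k = p ^ (k - s) * p ^ s := by
        rw [← pow_add]; congr 1; omega
      have hiff : (Equiv.addRight (((u⁻¹ : (ZMod (p ^ j))ˣ) : ZMod (p ^ j)) *
            (p : ZMod (p ^ j)) ^ (k - s))) z *
          ((p : ZMod (p ^ j)) ^ s * ((u * m₁ : (ZMod (p ^ j))ˣ) : ZMod (p ^ j))) =
            (p : ZMod (p ^ j)) ^ k * m₁ ↔ (p : ZMod (p ^ j)) ^ s * z = 0 := by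
        rw [← (u * m₁).isUnit.mul_left_inj (b := (p : ZMod (p ^ j)) ^ s * z), zero_mul,
          ← sub_eq_zero]
        apply Eq.congr_left
        simp only [Equiv.coe_addRight, Units.val_mul]
        rw [hpk]
        linear_combination (p : ZMod (p ^ j)) ^ (k - s) * p ^ s * m₁ * hu
      simp only [hiff]
      split_ifs
      · rw [← AddChar.map_add_eq_mul]
        congr 1
        simp only [Equiv.coe_addRight, Units.val_mul]
        ring
      · simp
    refine (congrArg _ (Finset.sum_congr rfl fun u _ => hk u)).trans ?_
    rw [← Finset.mul_sum]
    split_ifs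
    · rw [inv_mul_cancel_left₀ (pow_ne_zero _ hp0)]
    · simp

/-- The quadratic polynomial `∑ T i k v_i v_k` over a commutative ring. -/
def evalQ {n : ℕ} (T : Matrix (Fin n) (Fin n) ℤ) {R : Type*} [CommRing R] (v : Fin n → R) : R :=
  ∑ i, ∑ k, (T i k : R) * v i * v k

/-- The linear polynomial `∑ w i v_i` over a commutative ring. -/
def evalL {n : ℕ} (w : Fin n → ℤ) {R : Type*} [CommRing R] (v : Fin n → R) : R :=
  ∑ i, (w i : R) * v i

section eval

variable {n : ℕ} (T : Matrix (Fin n) (Fin n) ℤ) (w : Fin n → ℤ) {R R' : Type*} [CommRing R]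
  [CommRing R']

lemma map_evalQ (f : R →+* R') (v : Fin n → R) :
    f (evalQ T v) = evalQ T fun i => f (v i) := by
  simp [evalQ]

lemma map_evalL (f : R →+* R') (v : Fin n → R) :
    f (evalL w v) = evalL w fun i => f (v i) := by
  simp [evalL]

lemma evalQ_mul (c : R) (v : Fin n → R) : evalQ T (fun i => c * v i) = c ^ 2 * evalQ T v := by
  simp only [evalQ, Finset.mul_sum]
  exact Finset.sum_congr rfl fun i _ => Finset.sum_congr rfl fun k _ => by ring

lemma evalL_mul (c : R) (v : Fin n → R) : evalL w (fun i => c * v i) = c * evalL w v := by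
  simp only [evalL, Finset.mul_sum]
  exact Finset.sum_congr rfl fun i _ => by ring

lemma evalL_dvd {a : ℤ} (h : ∀ i, a ∣ w i) (v : Fin n → R) : ∃ z : R, evalL w v = (a : R) * z := by
  choose b hb using h
  refine ⟨evalL b v, ?_⟩
  simp only [evalL, hb, Finset.mul_sum]
  exact Finset.sum_congr rfl fun i _ => by push_cast; ring

end eval

section reduction

/-- The reduction map `ℤ/p^ν → ℤ/p^j`. -/
def red (p : ℕ) {i j ν : ℕ} (h : i + j = ν) : ZMod (p ^ ν) →+* ZMod (p ^ j) :=
  ZMod.castHom (pow_dvd_pow p (by omega)) (ZMod (p ^ j))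

variable {i j ν : ℕ} (h : i + j = ν)

omit hp in
lemma red_surjective : Function.Surjective (red p h) := ZMod.castHom_surjective _

lemma stdAddChar_ppow_mul (x : ZMod (p ^ ν)) :
    (ZMod.stdAddChar ((p : ZMod (p ^ ν)) ^ i * x) : ℂ) = ZMod.stdAddChar (red p h x) := by
  obtain ⟨a, rfl⟩ := ZMod.intCast_surjective x
  have hp0 : (p : ℂ) ≠ 0 := by exact_mod_cast hp.out.ne_zero
  have e : (p : ZMod (p ^ ν)) ^ i * (a : ZMod (p ^ ν)) = (((p : ℤ) ^ i * a : ℤ) : ZMod (p ^ ν)) := by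
    push_cast; rfl
  rw [map_intCast, e, ZMod.stdAddChar_coe, ZMod.stdAddChar_coe, ← h]
  congr 1
  push_cast
  rw [pow_add]
  field_simp

lemma sum_red (F : ZMod (p ^ j) → ℂ) : ∑ x, F (red p h x) = (p : ℂ) ^ i * ∑ x, F x := by
  have key := card_mul_sum_comp (red p h).toAddMonoidHom (red_surjective h) F
  have hp0 : (p : ℂ) ^ j ≠ 0 := pow_ne_zero _ (by exact_mod_cast hp.out.ne_zero)
  refine mul_left_cancel₀ hp0 ?_
  rw [← mul_assoc, ← pow_add, add_comm j, h]
  simpa [ZMod.card] using key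

lemma sum_red_pi {n : ℕ} (F : (Fin n → ZMod (p ^ j)) → ℂ) :
    ∑ v : Fin n → ZMod (p ^ ν), F (fun k => red p h (v k)) = (p : ℂ) ^ (i * n) * ∑ v, F v := by
  have key := card_mul_sum_comp ((red p h).toAddMonoidHom.compLeft (Fin n))
    (fun v => ⟨fun k => (red_surjective h (v k)).choose,
      funext fun k => (red_surjective h (v k)).choose_spec⟩) F
  have hp0 : (p : ℂ) ^ (j * n) ≠ 0 := pow_ne_zero _ (by exact_mod_cast hp.out.ne_zero)
  refine mul_left_cancel₀ hp0 ?_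
  rw [← mul_assoc, ← pow_add, ← add_mul, add_comm j, h]
  simp only [Fintype.card_fun, ZMod.card, Fintype.card_fin, Nat.cast_pow, ← pow_mul] at key
  exact key

omit hp in
lemma isUnit_red (hj : 0 < j) (x : ZMod (p ^ ν)) : IsUnit (red p h x) ↔ IsUnit x := by
  obtain ⟨a, rfl⟩ := ZMod.intCast_surjective x
  rw [map_intCast, ZMod.coe_int_isUnit_iff_isCoprime, ZMod.coe_int_isUnit_iff_isCoprime]
  push_cast
  rw [IsCoprime.pow_left_iff hj, IsCoprime.pow_left_iff (by omega)]

lemma sum_units_red (hj : 0 < j) (F : ZMod (p ^ j) → ℂ) :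
    ∑ u : (ZMod (p ^ ν))ˣ, F (red p h u) = (p : ℂ) ^ i * ∑ u : (ZMod (p ^ j))ˣ, F u := by
  classical
  rw [sum_units_eq F, sum_units_eq fun x => F (red p h x), ← sum_red h]
  simp only [isUnit_red h hj]

lemma ppow_mul_red_eq_zero {a b t : ℕ} (ha : a + t = ν) (hb : b + t = j) (x : ZMod (p ^ ν)) :
    (p : ZMod (p ^ j)) ^ b * red p h x = 0 ↔ (p : ZMod (p ^ ν)) ^ a * x = 0 := by
  obtain ⟨c, rfl⟩ := ZMod.intCast_surjective x
  rw [map_intCast, ppow_mul_intCast_eq_zero ha, ppow_mul_intCast_eq_zero hb]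

end reduction

section counting

variable (p) {n : ℕ} (T : Matrix (Fin n) (Fin n) ℤ) (w : Fin n → ℤ) (l m₁ : ℤ) (k : ℕ)

/-- `p^{k-t} Q(v) - w·v + p^t l m₁` over a commutative ring. -/
def inhom (t : ℕ) {R : Type*} [CommRing R] (v : Fin n → R) : R :=
  (p : R) ^ (k - t) * evalQ T v - evalL w v + (p : R) ^ t * (l : R) * (m₁ : R)

/-- The exponential sum over the isotropic vectors of the hyperbolic extension. -/
noncomputable def isoSum (j : ℕ) : ℂ :=
  ∑ v : Fin n → ZMod (p ^ j), ∑ x : ZMod (p ^ j), ∑ y : ZMod (p ^ j),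
    if x * y = evalQ T v then
      ZMod.stdAddChar ((l : ZMod (p ^ j)) * y + (p : ZMod (p ^ j)) ^ k *
        (m₁ : ZMod (p ^ j)) * x - evalL w v) else 0

/-- The primitive part of `isoSum`. -/
noncomputable def primSum (j t : ℕ) : ℂ :=
  ∑ v : Fin n → ZMod (p ^ j), if (p : ZMod (p ^ j)) ^ (j - t) * evalQ T v = 0 then
    ∑ u : (ZMod (p ^ j))ˣ,
      ZMod.stdAddChar ((u : ZMod (p ^ j)) * inhom p T w l m₁ k t v) else 0

/-- The number of zeros of `Q` modulo `p^t`. -/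
noncomputable def zeroCount (t : ℕ) : ℂ :=
  ∑ v : Fin n → ZMod (p ^ t), if evalQ T v = 0 then 1 else 0

/-- The number of solutions modulo `p^ν` of `p^t ∣ Q(v)` and `inhom t v = 0`. -/
noncomputable def repCount (ν t : ℕ) : ℂ :=
  ∑ v : Fin n → ZMod (p ^ ν), if (p : ZMod (p ^ ν)) ^ (ν - t) * evalQ T v = 0 ∧
    inhom p T w l m₁ k t v = 0 then 1 else 0

variable {p T w l m₁ k}

omit hp in
lemma map_inhom (t : ℕ) {R R' : Type*} [CommRing R] [CommRing R'] (f : R →+* R') (v : Fin n → R) :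
    f (inhom p T w l m₁ k t v) = inhom p T w l m₁ k t fun i => f (v i) := by
  simp [inhom, map_evalQ, map_evalL]

lemma isoSum_eq (hw : ∀ i, (p : ℤ) ^ k ∣ w i) (hm₁ : ¬ (p : ℤ) ∣ m₁) (j : ℕ) :
    isoSum p T w l m₁ k j = (if j ≤ k then (p : ℂ) ^ j * zeroCount p T j else 0) +
      ∑ t ∈ Finset.range (min j (k + 1)), primSum p T w l m₁ k j t := by
  have hu : IsUnit (m₁ : ZMod (p ^ j)) := by
    rw [ZMod.coe_int_isUnit_iff_isCoprime]
    push_cast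
    exact ((Nat.prime_iff_prime_int.1 hp.out).irreducible.coprime_iff_not_dvd.2 hm₁).pow_left
  obtain ⟨m₂, hm₂⟩ := hu
  have h1 : ∀ v : Fin n → ZMod (p ^ j), (∑ x : ZMod (p ^ j), ∑ y : ZMod (p ^ j),
      if x * y = evalQ T v then (ZMod.stdAddChar ((l : ZMod (p ^ j)) * y +
        (p : ZMod (p ^ j)) ^ k * (m₁ : ZMod (p ^ j)) * x - evalL w v) : ℂ) else 0) =
      (if j ≤ k then (p : ℂ) ^ j * (if evalQ T v = 0 then 1 else 0) else 0) +
      ∑ t ∈ Finset.range (min j (k + 1)),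
        if (p : ZMod (p ^ j)) ^ (j - t) * evalQ T v = 0 then
          ∑ u : (ZMod (p ^ j))ˣ, (ZMod.stdAddChar ((u : ZMod (p ^ j)) *
              ((l : ZMod (p ^ j)) * (p : ZMod (p ^ j)) ^ t * (m₂ : ZMod (p ^ j))) +
            ((u⁻¹ : (ZMod (p ^ j))ˣ) : ZMod (p ^ j)) *
              (evalQ T v * (p : ZMod (p ^ j)) ^ (k - t)) - evalL w v) : ℂ)
        else 0 := by
    intro v
    have h2 := congrArg (· * (ZMod.stdAddChar (-evalL w v) : ℂ))
      ((sum_hyperbola_swap j (l : ZMod (p ^ j))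
        ((p : ZMod (p ^ j)) ^ k * (m₂ : ZMod (p ^ j))) (evalQ T v)).trans
        (sum_hyperbola_eq j k (l : ZMod (p ^ j)) (evalQ T v) m₂))
    simp only [Finset.sum_mul, add_mul, ite_mul, zero_mul, ← AddChar.map_add_eq_mul,
      ← sub_eq_add_neg, hm₂] at h2
    rw [h2, hm₂]
    congr 1
    by_cases hjk : j ≤ k
    · obtain ⟨z, hz⟩ := evalL_dvd w hw v
      have : (p : ZMod (p ^ j)) ^ k = 0 := by
        rw [← Nat.sub_add_cancel hjk, pow_add, ppow_eq_zero, mul_zero]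
      have h0 : evalL w v = 0 := by rw [hz]; push_cast; rw [this, zero_mul]
      simp [h0]
    · simp [hjk]
  rw [isoSum, Finset.sum_congr rfl fun v _ => h1 v, Finset.sum_add_distrib]
  congr 1
  · split_ifs
    · rw [zeroCount, Finset.mul_sum]
    · simp
  · rw [Finset.sum_comm]
    refine Finset.sum_congr rfl fun t _ => ?_
    simp only [primSum, ← Finset.sum_filter]
    simp only [Finset.sum_filter]
    have h3 : ∀ (P : Prop) [Decidable P] (f : (ZMod (p ^ j))ˣ → ℂ),
        (if P then ∑ u, f u else 0) = ∑ u, if P then f u else 0 := by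
      intro P _ f; split_ifs <;> simp
    simp only [h3]
    rw [Finset.sum_comm]
    conv_rhs => rw [Finset.sum_comm]
    refine Finset.sum_congr rfl fun u _ => ?_
    rw [← Equiv.sum_comp (Equiv.piCongrRight fun _ : Fin n => Units.mulLeft u)]
    refine Finset.sum_congr rfl fun v _ => ?_
    have e : (Equiv.piCongrRight fun _ : Fin n => Units.mulLeft u) v =
      fun i => (u : ZMod (p ^ j)) * v i := rfl
    rw [e, evalQ_mul, evalL_mul]
    have e2 : (p : ZMod (p ^ j)) ^ (j - t) * ((u : ZMod (p ^ j)) ^ 2 * evalQ T v) = 0 ↔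
        (p : ZMod (p ^ j)) ^ (j - t) * evalQ T v = 0 := by
      have e3 : (p : ZMod (p ^ j)) ^ (j - t) * ((u : ZMod (p ^ j)) ^ 2 * evalQ T v) =
          (p : ZMod (p ^ j)) ^ (j - t) * evalQ T v * (u ^ 2 : (ZMod (p ^ j))ˣ) := by
        push_cast; ring
      rw [e3, (u ^ 2).isUnit.mul_left_eq_zero]
    simp only [e2]
    split_ifs
    · congr 1
      have hu : ((u⁻¹ : (ZMod (p ^ j))ˣ) : ZMod (p ^ j)) * u = 1 := u.inv_mul
      rw [inhom, ← hm₂]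
      linear_combination ((u : ZMod (p ^ j)) * evalQ T v * (p : ZMod (p ^ j)) ^ (k - t)) * hu
    · rfl

lemma repCount_eq (hw : ∀ i, (p : ℤ) ^ k ∣ w i) {ν t : ℕ} (ht : t ≤ ν) (htk : t ≤ k) :
    (p : ℂ) ^ ν * repCount p T w l m₁ k ν t =
      (p : ℂ) ^ ((ν - t) * n) * ((p : ℂ) ^ t * zeroCount p T t) +
      ∑ i ∈ Finset.range (ν - t), (p : ℂ) ^ (i * n) * primSum p T w l m₁ k (ν - i) t := by
  have hp0 : (p : ℂ) ≠ 0 := by exact_mod_cast hp.out.ne_zero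
  have h1 : ∀ v : Fin n → ZMod (p ^ ν), (p : ℂ) ^ ν *
      (if (p : ZMod (p ^ ν)) ^ (ν - t) * evalQ T v = 0 ∧ inhom p T w l m₁ k t v = 0
        then (1 : ℂ) else 0) =
      (if (p : ZMod (p ^ ν)) ^ (ν - t) * evalQ T v = 0 then (p : ℂ) ^ t else 0) +
      ∑ i ∈ Finset.range (ν - t), ((p : ℂ) ^ i)⁻¹ *
        if (p : ZMod (p ^ ν)) ^ (ν - t) * evalQ T v = 0 then
          ∑ u : (ZMod (p ^ ν))ˣ, (ZMod.stdAddChar ((p : ZMod (p ^ ν)) ^ i *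
            ((u : ZMod (p ^ ν)) * inhom p T w l m₁ k t v)) : ℂ) else 0 := by
    intro v
    by_cases hv : (p : ZMod (p ^ ν)) ^ (ν - t) * evalQ T v = 0
    · have h2 := sum_eq_unit_strata (p := p) (j := ν) (Nat.sub_le ν t)
        fun c => (ZMod.stdAddChar (c * inhom p T w l m₁ k t v) : ℂ)
      rw [sum_stdAddChar] at h2
      have hX : (p : ZMod (p ^ ν)) ^ (ν - t) * inhom p T w l m₁ k t v = 0 := by
        obtain ⟨z, hz⟩ := evalL_dvd w hw v
        have e1 : (p : ZMod (p ^ ν)) ^ (ν - t) * (p : ZMod (p ^ ν)) ^ t = 0 := by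
          rw [← pow_add, Nat.sub_add_cancel ht, ppow_eq_zero]
        have e2 : (p : ZMod (p ^ ν)) ^ k = p ^ t * p ^ (k - t) := by
          rw [← pow_add, Nat.add_sub_cancel' htk]
        rw [inhom, hz]
        push_cast
        rw [e2]
        linear_combination (p : ZMod (p ^ ν)) ^ (k - t) * hv +
          (l * m₁ - (p : ZMod (p ^ ν)) ^ (k - t) * z) * e1
      have h3 : ((p : ℂ) ^ (ν - t))⁻¹ * ∑ c : ZMod (p ^ ν), (ZMod.stdAddChar
          ((p : ZMod (p ^ ν)) ^ (ν - t) * c * inhom p T w l m₁ k t v) : ℂ) = (p : ℂ) ^ t := by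
        have : ∀ c, (p : ZMod (p ^ ν)) ^ (ν - t) * c * inhom p T w l m₁ k t v = 0 := fun c => by
          linear_combination c * hX
        simp only [this, AddChar.map_zero_eq_one, Finset.sum_const, Finset.card_univ, ZMod.card]
        rw [nsmul_one, inv_mul_eq_iff_eq_mul₀ (pow_ne_zero _ hp0), ← pow_add,
          Nat.sub_add_cancel ht]
        push_cast; rfl
      rw [h3] at h2
      simp only [hv, true_and, if_true]
      rw [mul_ite, mul_one, mul_zero, h2]
      simp only [mul_assoc]
    · simp [hv]
  rw [repCount, Finset.mul_sum, Finset.sum_congr rfl fun v _ => h1 v, Finset.sum_add_distrib]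
  congr 1
  · have h4 := sum_red_pi (p := p) (i := ν - t) (j := t) (ν := ν) (by omega) (n := n)
      fun v => if evalQ T v = 0 then (p : ℂ) ^ t else 0
    have h5 : (p : ℂ) ^ t * zeroCount p T t =
        ∑ v : Fin n → ZMod (p ^ t), if evalQ T v = 0 then (p : ℂ) ^ t else 0 := by
      simp only [zeroCount, Finset.mul_sum, mul_ite, mul_one, mul_zero]
    rw [h5, ← h4]
    refine Finset.sum_congr rfl fun v _ => ?_
    have := ppow_mul_red_eq_zero (p := p) (i := ν - t) (j := t) (ν := ν) (by omega)
      (a := ν - t) (b := 0) (t := t) (by omega) (by omega) (evalQ T v)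
    rw [pow_zero, one_mul, map_evalQ] at this
    simp only [this]
  · rw [Finset.sum_comm]
    refine Finset.sum_congr rfl fun i hi => ?_
    have hi' := Finset.mem_range.1 hi
    have hν : i + (ν - i) = ν := by omega
    rw [primSum, ← sum_red_pi hν]
    refine Finset.sum_congr rfl fun v _ => ?_
    have := ppow_mul_red_eq_zero (p := p) hν
      (a := ν - t) (b := ν - i - t) (t := t) (by omega) (by omega) (evalQ T v)
    rw [map_evalQ] at this
    simp only [this]
    split_ifs
    · simp only [stdAddChar_ppow_mul hν, map_mul, map_inhom]
      rw [sum_units_red hν (by omega) fun u => (ZMod.stdAddChar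
        (u * inhom p T w l m₁ k t fun r => red p hν (v r)) : ℂ),
        inv_mul_cancel_left₀ (pow_ne_zero _ hp0)]
    · simp

theorem sum_isoSum_eq (hw : ∀ i, (p : ℤ) ^ k ∣ w i) (hm₁ : ¬ (p : ℤ) ∣ m₁) (ν : ℕ) :
    ∑ j ∈ Finset.range (ν + 1), (p : ℂ) ^ ((ν - j) * n) * isoSum p T w l m₁ k j =
      (p : ℂ) ^ ν * ∑ t ∈ Finset.range (min ν k + 1), repCount p T w l m₁ k ν t := by
  rw [Finset.mul_sum, Finset.sum_congr rfl fun t ht => repCount_eq hw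
    (by have := Finset.mem_range.1 ht; omega) (by have := Finset.mem_range.1 ht; omega),
    Finset.sum_congr rfl fun j _ => congrArg _ (isoSum_eq hw hm₁ j)]
  simp only [mul_add, Finset.sum_add_distrib]
  congr 1
  · rw [← Finset.sum_subset (Finset.range_mono (show min ν k + 1 ≤ ν + 1 by omega))]
    · refine Finset.sum_congr rfl fun j hj => ?_
      rw [if_pos (by have := Finset.mem_range.1 hj; omega)]
    · intro j hj hj'
      simp only [Finset.mem_range] at hj hj'
      rw [if_neg (by omega), mul_zero]
  · have h1 : ∀ t ∈ Finset.range (min ν k + 1), ∑ i ∈ Finset.range (ν - t),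
        (p : ℂ) ^ (i * n) * primSum p T w l m₁ k (ν - i) t =
        ∑ j ∈ Finset.Ioc t ν, (p : ℂ) ^ ((ν - j) * n) * primSum p T w l m₁ k j t := by
      intro t ht
      have := Finset.mem_range.1 ht
      refine Finset.sum_bij' (fun i _ => ν - i) (fun j _ => ν - j) ?_ ?_ ?_ ?_ ?_
      · intro i hi; simp only [Finset.mem_range, Finset.mem_Ioc] at *; omega
      · intro i hi; simp only [Finset.mem_range, Finset.mem_Ioc] at *; omega
      · intro i hi; simp only [Finset.mem_range] at *; omega
      · intro i hi; simp only [Finset.mem_Ioc] at *; omega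
      · intro i hi
        simp only [Finset.mem_range] at hi
        rw [show ν - (ν - i) = i by omega]
    rw [Finset.sum_congr rfl h1]
    simp only [Finset.mul_sum]
    refine Finset.sum_comm' fun j t => ?_
    simp only [Finset.mem_range, Finset.mem_Ioc]
    omega

end counting

section hyperbolic

variable {R : Type} {n : ℕ}

lemma sum_fin_add_two [AddCommMonoid R] (f : Fin (n + 2) → R) :
    ∑ i, f i = f ⟨0, by omega⟩ + ∑ i, vmid f i + vlast f := by
  rw [Fin.sum_univ_succ, Fin.sum_univ_castSucc, ← add_assoc]
  rfl

lemma val_ne (i : Fin n) : (i : ℕ) ≠ n := i.isLt.ne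

lemma bilin_hyp {K : Type} [Field K] (A : Matrix (Fin n) (Fin n) ℤ) (u v : Fin (n + 2) → K) :
    bilin K (hyp A) u v =
      u ⟨0, by omega⟩ * vlast v + vlast u * v ⟨0, by omega⟩ + bilin K A (vmid u) (vmid v) := by
  simp only [bilin, dotProduct, mulVec, sum_fin_add_two, Matrix.map_apply]
  simp [hyp, vmid, vlast, val_ne]
  ring

lemma bilin_neg {K : Type} [Field K] (A : Matrix (Fin n) (Fin n) ℤ) (u v : Fin n → K) :
    bilin K (-A) u v = -bilin K A u v := by
  simp [bilin, dotProduct, mulVec]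

lemma hyp_mulVec_zero {K : Type} [Field K] (A : Matrix (Fin n) (Fin n) ℤ) (v : Fin (n + 2) → K) :
    ((hyp A).map (Int.cast : ℤ → K)).mulVec v ⟨0, by omega⟩ = vlast v := by
  simp only [dotProduct, mulVec, sum_fin_add_two, Matrix.map_apply]
  simp [hyp, vmid, vlast, val_ne]

lemma hyp_mulVec_last {K : Type} [Field K] (A : Matrix (Fin n) (Fin n) ℤ) (v : Fin (n + 2) → K) :
    ((hyp A).map (Int.cast : ℤ → K)).mulVec v ⟨n + 1, by omega⟩ = v ⟨0, by omega⟩ := by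
  simp only [dotProduct, mulVec, sum_fin_add_two, Matrix.map_apply]
  simp [hyp, vmid, vlast]

lemma hyp_mulVec_mid {K : Type} [Field K] (A : Matrix (Fin n) (Fin n) ℤ) (v : Fin (n + 2) → K)
    (i : Fin n) :
    ((hyp A).map (Int.cast : ℤ → K)).mulVec v ⟨i + 1, by omega⟩ =
      (A.map (Int.cast : ℤ → K)).mulVec (vmid v) i := by
  simp only [dotProduct, mulVec, sum_fin_add_two, Matrix.map_apply]
  simp [hyp, vmid, vlast, val_ne]

lemma forall_fin_add_two {P : Fin (n + 2) → Prop} :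
    (∀ i, P i) ↔ P ⟨0, by omega⟩ ∧ (∀ i : Fin n, P ⟨i + 1, by omega⟩) ∧ P ⟨n + 1, by omega⟩ := by
  refine ⟨fun h => ⟨h _, fun i => h _, h _⟩, fun ⟨h0, h1, h2⟩ i => ?_⟩
  obtain ⟨i, hi⟩ := i
  rcases Nat.eq_zero_or_pos i with rfl | hi0
  · exact h0
  · rcases eq_or_ne i (n + 1) with rfl | hi1
    · exact h2
    · have := h1 ⟨i - 1, by omega⟩
      simpa [Nat.sub_add_cancel hi0] using this

/-- Splitting a vector into its first, middle and last components. -/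
def splitEquiv (R : Type) (n : ℕ) : (Fin (n + 2) → R) ≃ (Fin n → R) × R × R where
  toFun d := (vmid d, d ⟨0, by omega⟩, vlast d)
  invFun x i := if h0 : (i : ℕ) = 0 then x.2.1
    else if h1 : (i : ℕ) = n + 1 then x.2.2
    else x.1 ⟨(i : ℕ) - 1, by have := i.isLt; omega⟩
  left_inv d := by
    refine funext (forall_fin_add_two.2 ⟨?_, fun i => ?_, ?_⟩)
    · simp
    · simp [vmid, val_ne]
    · simp [vlast]
  right_inv x := by
    refine Prod.ext (funext fun i => ?_) (Prod.ext ?_ ?_)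
    · simp [vmid, val_ne]
    · simp
    · simp [vlast]

lemma sum_split [Fintype R] (F : (Fin n → R) → R → R → ℂ) :
    ∑ d : Fin (n + 2) → R, F (vmid d) (d ⟨0, by omega⟩) (vlast d) = ∑ v, ∑ x, ∑ y, F v x y := by
  have := Equiv.sum_comp (splitEquiv R n) fun z => F z.1 z.2.1 z.2.2
  simp only [Fintype.sum_prod_type] at this
  exact this

lemma sum_piFinset_range (N : ℕ) [NeZero N] (F : (Fin n → ZMod N) → ℂ) :
    ∑ d ∈ Fintype.piFinset fun _ : Fin n => Finset.range N, F (fun i => (d i : ZMod N)) =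
      ∑ v, F v := by
  refine Finset.sum_bij' (fun d _ i => (d i : ZMod N)) (fun v _ i => (v i).val) ?_ ?_ ?_ ?_ ?_
  · intro d _; exact Finset.mem_univ _
  · intro v _; simp [Fintype.mem_piFinset, ZMod.val_lt]
  · intro d hd
    ext i
    exact ZMod.val_cast_of_lt (Finset.mem_range.1 (Fintype.mem_piFinset.1 hd i))
  · intro v _; ext i; simp
  · intro d _; rfl

end hyperbolic

section forms

variable {n : ℕ} {S : Matrix (Fin n) (Fin n) ℤ}

/-- An upper triangular matrix representing the quadratic form of an even Gram matrix. -/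
def upper (S : Matrix (Fin n) (Fin n) ℤ) : Matrix (Fin n) (Fin n) ℤ :=
  fun i k => if i < k then S i k else if i = k then S i i / 2 else 0

lemma upper_add_upper (hsymm : S.IsSymm) (heven : ∀ v : Fin n → ℤ, 2 ∣ v ⬝ᵥ S.mulVec v)
    (i k : Fin n) : upper S i k + upper S k i = S i k := by
  rcases lt_trichotomy i k with h | rfl | h
  · simp [upper, h, h.not_gt, h.ne']
  · have := heven (Pi.single i 1)
    simp only [Matrix.mulVec_single_one, single_one_dotProduct, Matrix.col_apply] at this
    simp only [upper, lt_irrefl, if_false, if_true]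
    omega
  · have := hsymm.apply i k
    simp [upper, h, h.not_gt, h.ne', this]

lemma bilin_self_eq {K : Type} [Field K] (hsymm : S.IsSymm)
    (heven : ∀ v : Fin n → ℤ, 2 ∣ v ⬝ᵥ S.mulVec v) (v : Fin n → K) :
    bilin K S v v = 2 * evalQ (upper S) v := by
  have h : evalQ (upper S) v = ∑ i, ∑ k, (upper S k i : K) * v i * v k := by
    rw [evalQ, Finset.sum_comm]
    exact Finset.sum_congr rfl fun i _ => Finset.sum_congr rfl fun k _ => by ring
  rw [two_mul]
  nth_rewrite 2 [h]
  simp only [evalQ, bilin, dotProduct, mulVec, Matrix.map_apply, ← Finset.sum_add_distrib,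
    Finset.mul_sum]
  refine Finset.sum_congr rfl fun i _ => Finset.sum_congr rfl fun k _ => ?_
  rw [← upper_add_upper hsymm heven i k]
  push_cast; ring

lemma quadF_eq (hsymm : S.IsSymm) (heven : ∀ v : Fin n → ℤ, 2 ∣ v ⬝ᵥ S.mulVec v)
    (v : Fin n → ℚ) : quadF ℚ S v = evalQ (upper S) v := by
  rw [quadF, bilin_self_eq hsymm heven]; ring

lemma bilin_comm {K : Type} [Field K] (hsymm : S.IsSymm) (u v : Fin n → K) :
    bilin K S u v = bilin K S v u := by
  simp only [bilin, dotProduct, mulVec, Matrix.map_apply, Finset.mul_sum]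
  rw [Finset.sum_comm]
  refine Finset.sum_congr rfl fun i _ => Finset.sum_congr rfl fun k _ => ?_
  rw [hsymm.apply i k]; ring

lemma bilin_dual {μ : Fin n → ℚ} {w : Fin n → ℤ}
    (hw : ∀ i, (S.map (Int.cast : ℤ → ℚ)).mulVec μ i = w i) (v : Fin n → ℚ) :
    bilin ℚ S v μ = evalL w v := by
  simp only [bilin, dotProduct, hw, evalL]
  exact Finset.sum_congr rfl fun i _ => mul_comm _ _

lemma intCast_mulVec {m : ℕ} (A : Matrix (Fin m) (Fin m) ℤ) (v : Fin m → ℤ) (i : Fin m) :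
    (A.map (Int.cast : ℤ → ℚ)).mulVec (fun k => (v k : ℚ)) i = (A.mulVec v i : ℤ) := by
  simp [mulVec, dotProduct]

lemma dvd_ratGcd {m : ℕ} {a : ℕ} {v : Fin m → ℚ} :
    a ∣ ratGcd v ↔ ∀ i, (a : ℤ) ∣ (v i).num := by
  simp [ratGcd, Finset.dvd_gcd_iff, Int.natCast_dvd]

/-- `d₀ d_{n+1} - Q(d')`. -/
def hypQ (T : Matrix (Fin n) (Fin n) ℤ) {R : Type} [CommRing R] (d : Fin (n + 2) → R) : R :=
  d ⟨0, by omega⟩ * vlast d - evalQ T (vmid d)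

/-- `l d_{n+1} + m d₀ - w·d'`. -/
def hypL (w : Fin n → ℤ) (l m : ℤ) {R : Type} [CommRing R] (d : Fin (n + 2) → R) : R :=
  (l : R) * vlast d + (m : R) * d ⟨0, by omega⟩ - evalL w (vmid d)

lemma map_hypQ (T : Matrix (Fin n) (Fin n) ℤ) {R R' : Type} [CommRing R] [CommRing R']
    (f : R →+* R') (d : Fin (n + 2) → R) : f (hypQ T d) = hypQ T fun i => f (d i) := by
  simp only [hypQ, map_sub, map_mul, map_evalQ]; rfl

lemma map_hypL (w : Fin n → ℤ) (l m : ℤ) {R R' : Type} [CommRing R] [CommRing R']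
    (f : R →+* R') (d : Fin (n + 2) → R) : f (hypL w l m d) = hypL w l m fun i => f (d i) := by
  simp only [hypL, map_sub, map_add, map_mul, map_evalL, map_intCast]; rfl

lemma hypQ_mul (T : Matrix (Fin n) (Fin n) ℤ) {R : Type} [CommRing R] (c : R)
    (d : Fin (n + 2) → R) : hypQ T (fun i => c * d i) = c ^ 2 * hypQ T d := by
  have : vmid (fun i => c * d i) = fun i => c * vmid d i := rfl
  rw [hypQ, this, evalQ_mul, hypQ]
  simp only [vlast]
  ring

lemma hypL_mul (w : Fin n → ℤ) (l m : ℤ) {R : Type} [CommRing R] (c : R)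
    (d : Fin (n + 2) → R) : hypL w l m (fun i => c * d i) = c * hypL w l m d := by
  have : vmid (fun i => c * d i) = fun i => c * vmid d i := rfl
  rw [hypL, this, evalL_mul, hypL]
  simp only [vlast]
  ring

lemma quadF_MatS0 (hsymm : S.IsSymm) (heven : ∀ v : Fin n → ℤ, 2 ∣ v ⬝ᵥ S.mulVec v)
    (d : Fin (n + 2) → ℚ) : quadF ℚ (MatS0 n S) d = hypQ (upper S) d := by
  rw [quadF, MatS0, bilin_hyp, bilin_neg, bilin_self_eq hsymm heven, hypQ]; ring

lemma vmid_asmVec (l m : ℚ) (μ : Fin n → ℚ) : vmid (asmVec n l μ m) = μ := by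
  ext i; simp [vmid, asmVec, val_ne]

lemma bilin_MatS0 (hsymm : S.IsSymm) {μ : Fin n → ℚ} {w : Fin n → ℤ}
    (hw : ∀ i, (S.map (Int.cast : ℤ → ℚ)).mulVec μ i = w i) (l m : ℤ) (d : Fin (n + 2) → ℚ) :
    bilin ℚ (MatS0 n S) (asmVec n l μ m) d = hypL w l m d := by
  rw [MatS0, bilin_hyp, bilin_neg, vmid_asmVec, bilin_comm hsymm, bilin_dual hw, hypL]
  simp [vlast, asmVec]
  ring

end forms

section primitivity

variable {n : ℕ} {S : Matrix (Fin n) (Fin n) ℤ}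

lemma evalQ_intCast (T : Matrix (Fin n) (Fin n) ℤ) {R : Type} [CommRing R] (v : Fin n → ℤ) :
    evalQ T (fun i => (v i : R)) = (evalQ T v : ℤ) :=
  (map_evalQ T (Int.castRingHom R) v).symm

lemma evalL_intCast (w : Fin n → ℤ) {R : Type} [CommRing R] (v : Fin n → ℤ) :
    evalL w (fun i => (v i : R)) = (evalL w v : ℤ) :=
  (map_evalL w (Int.castRingHom R) v).symm

lemma hypQ_intCast (T : Matrix (Fin n) (Fin n) ℤ) {R : Type} [CommRing R] (d : Fin (n + 2) → ℤ) :
    hypQ T (fun i => (d i : R)) = (hypQ T d : ℤ) :=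
  (map_hypQ T (Int.castRingHom R) d).symm

lemma hypL_intCast (w : Fin n → ℤ) (l m : ℤ) {R : Type} [CommRing R] (d : Fin (n + 2) → ℤ) :
    hypL w l m (fun i => (d i : R)) = (hypL w l m d : ℤ) :=
  (map_hypL w l m (Int.castRingHom R) d).symm

include hp in
lemma dvd_of_pMaximal (hsymm : S.IsSymm) (heven : ∀ v : Fin n → ℤ, 2 ∣ v ⬝ᵥ S.mulVec v)
    (hmax : pMaximal n S p) {v : Fin n → ℤ} (h₁ : ∀ i, (p : ℤ) ∣ S.mulVec v i)
    (h₂ : (p : ℤ) ^ 2 ∣ evalQ (upper S) v) (i : Fin n) : (p : ℤ) ∣ v i := by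
  have hp0 : (p : ℚ) ≠ 0 := by exact_mod_cast hp.out.ne_zero
  have hdual : inDual S fun k => (p : ℚ)⁻¹ * v k := by
    intro k
    obtain ⟨z, hz⟩ := h₁ k
    refine ⟨z, ?_⟩
    have := intCast_mulVec S v k
    rw [hz] at this
    have e : (fun k => (p : ℚ)⁻¹ * (v k : ℚ)) = (p : ℚ)⁻¹ • fun k => (v k : ℚ) := rfl
    rw [e, Matrix.mulVec_smul, Pi.smul_apply, this]
    push_cast
    simp [hp0]
  have hint : ∃ z : ℤ, quadF ℚ S (fun k => (p : ℚ)⁻¹ * v k) = z := by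
    obtain ⟨z, hz⟩ := h₂
    refine ⟨z, ?_⟩
    rw [quadF_eq hsymm heven, evalQ_mul, evalQ_intCast, hz]
    push_cast
    field_simp
  have hord := hmax _ hdual hint
  have hmem : ordv (fun k => (p : ℚ)⁻¹ * v k) ∈
      {N : ℕ | 0 < N ∧ ∀ i, ∃ z : ℤ, (N : ℚ) * ((p : ℚ)⁻¹ * v i) = (z : ℚ)} :=
    Nat.sInf_mem ⟨p, hp.out.pos, fun k => ⟨v k, by field_simp⟩⟩
  obtain ⟨z, hz⟩ := hmem.2 i
  have hz' : (ordv (fun k => (p : ℚ)⁻¹ * v k) : ℤ) * v i = p * z := by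
    have : (ordv (fun k => (p : ℚ)⁻¹ * v k) : ℚ) * v i = p * z := by
      rw [← hz]; field_simp
    exact_mod_cast this
  refine ((Nat.prime_iff_prime_int.1 hp.out).dvd_or_dvd ⟨z, hz'⟩).resolve_left fun h => hord ?_
  exact_mod_cast h

lemma dvd_ratGcd_gExt (hsymm : S.IsSymm) (heven : ∀ v : Fin n → ℤ, 2 ∣ v ⬝ᵥ S.mulVec v)
    {d : Fin (n + 2) → ℕ} {γ : ℕ} (hγ : γ ≠ 0) {e : ℤ}
    (hq : hypQ (upper S) (fun i => (d i : ℤ)) = γ * e) (a : ℕ) :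
    a ∣ ratGcd (((MatS1 n S).map (Int.cast : ℤ → ℚ)).mulVec (gExt n S d γ)) ↔
      (a : ℤ) ∣ γ ∧ ((a : ℤ) ∣ d ⟨n + 1, by omega⟩ ∧
        (∀ i, (a : ℤ) ∣ S.mulVec (vmid fun i => (d i : ℤ)) i) ∧ (a : ℤ) ∣ d ⟨0, by omega⟩) ∧
      (a : ℤ) ∣ e := by
  have hγ' : (γ : ℚ) ≠ 0 := by exact_mod_cast hγ
  have hmid : vmid (m := n + 2) (gExt n S d γ) = fun i => (d i : ℚ) := by
    ext i
    have := i.isLt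
    simp [vmid, gExt, this.ne]
  have hlast : vlast (m := n + 2) (gExt n S d γ) = γ := by simp [vlast, gExt]
  have hzero : gExt n S d γ ⟨0, by omega⟩ = ((-e : ℤ) : ℚ) := by
    have h := hypQ_intCast (R := ℚ) (upper S) (fun i => (d i : ℤ))
    rw [hq] at h
    simp only [gExt, dif_pos, quadF_MatS0 hsymm heven]
    simp only [Int.cast_natCast] at h
    rw [h]
    push_cast
    field_simp
  have hSv : ∀ i, ((-S).map (Int.cast : ℤ → ℚ)).mulVec (vmid fun i => (d i : ℚ)) i =
      ((-(S.mulVec (vmid fun i => (d i : ℤ)) i) : ℤ) : ℚ) := by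
    intro i
    have := intCast_mulVec (-S) (vmid fun i => (d i : ℤ)) i
    rw [Matrix.neg_mulVec] at this
    exact this
  rw [dvd_ratGcd, MatS1, forall_fin_add_two (n := n + 2)]
  simp only [hyp_mulVec_zero, hyp_mulVec_last, hyp_mulVec_mid, hmid, hlast, hzero]
  rw [MatS0, forall_fin_add_two (n := n)]
  simp only [hyp_mulVec_zero, hyp_mulVec_last, hyp_mulVec_mid, hSv, vlast, Rat.num_intCast,
    Rat.num_natCast, dvd_neg]

lemma ratGcd_gExt_eq_one_iff (hsymm : S.IsSymm) (heven : ∀ v : Fin n → ℤ, 2 ∣ v ⬝ᵥ S.mulVec v)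
    (hmax : pMaximal n S p) {d : Fin (n + 2) → ℕ} {j : ℕ} {e : ℤ}
    (hq : hypQ (upper S) (fun i => (d i : ℤ)) = (p ^ (j + 1) : ℕ) * e) :
    ratGcd (((MatS1 n S).map (Int.cast : ℤ → ℚ)).mulVec (gExt n S d (p ^ (j + 1)))) = 1 ↔
      ¬ ((∀ i, p ∣ d i) ∧ (p : ℤ) ∣ e) := by
  have hγ : p ^ (j + 1) ≠ 0 := pow_ne_zero _ hp.out.ne_zero
  have key := dvd_ratGcd_gExt hsymm heven hγ hq
  set g := ratGcd (((MatS1 n S).map (Int.cast : ℤ → ℚ)).mulVec (gExt n S d (p ^ (j + 1))))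
  have hgp : g = 1 ↔ ¬ p ∣ g := by
    refine ⟨fun h => by rw [h]; exact hp.out.one_lt.ne' ∘ Nat.dvd_one.1, fun h => ?_⟩
    have h1 : g ∣ p ^ (j + 1) := by exact_mod_cast ((key g).1 dvd_rfl).1
    obtain ⟨i, -, hi⟩ := (Nat.dvd_prime_pow hp.out).1 h1
    rcases Nat.eq_zero_or_pos i with rfl | hi0
    · simpa using hi
    · exact absurd (hi ▸ dvd_pow_self p hi0.ne') h
  rw [hgp, not_iff_not, key]
  have hpj : (p : ℤ) ∣ (p ^ (j + 1) : ℕ) := by push_cast; exact dvd_pow_self _ (by omega)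
  constructor
  · rintro ⟨-, ⟨h1, h2, h3⟩, h4⟩
    refine ⟨forall_fin_add_two.2 ⟨by exact_mod_cast h3, fun i => ?_, by exact_mod_cast h1⟩, h4⟩
    have : (p : ℤ) ^ 2 ∣ evalQ (upper S) (vmid fun i => (d i : ℤ)) := by
      have e1 : evalQ (upper S) (vmid fun i => (d i : ℤ)) =
          (d ⟨0, by omega⟩ : ℤ) * d ⟨n + 1, by omega⟩ - (p ^ (j + 1) : ℕ) * e := by
        rw [← hq, hypQ, vlast]; ring
      rw [e1, sq]
      exact dvd_sub (mul_dvd_mul h3 h1) (mul_dvd_mul hpj h4)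
    exact Int.natCast_dvd_natCast.1 (dvd_of_pMaximal hsymm heven hmax h2 this i)
  · rintro ⟨h1, h2⟩
    refine ⟨hpj, ⟨by exact_mod_cast h1 _, fun i => ?_, by exact_mod_cast h1 _⟩, h2⟩
    rw [Matrix.mulVec, dotProduct]
    exact Finset.dvd_sum fun k _ => dvd_mul_of_dvd_right (Int.natCast_dvd_natCast.2 (h1 _)) _

end primitivity

section coefficients

variable {n : ℕ} {S : Matrix (Fin n) (Fin n) ℤ}

/-- The exponential sum over the representatives of the isotropic vectors modulo `p^j`. -/
noncomputable def natIsoSum (p : ℕ) [NeZero p] (T : Matrix (Fin n) (Fin n) ℤ) (w : Fin n → ℤ)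
    (l m : ℤ) (j : ℕ) : ℂ :=
  ∑ d ∈ Fintype.piFinset fun _ : Fin (n + 2) => Finset.range (p ^ j),
    if ((p ^ j : ℕ) : ℤ) ∣ hypQ T (fun i => (d i : ℤ)) then
      ZMod.stdAddChar ((hypL w l m (fun i => (d i : ℤ)) : ℤ) : ZMod (p ^ j)) else 0

lemma natIsoSum_eq_isoSum (T : Matrix (Fin n) (Fin n) ℤ) (w : Fin n → ℤ) (l m₁ : ℤ) (k j : ℕ) :
    natIsoSum p T w l (p ^ k * m₁) j = isoSum p T w l m₁ k j := by
  classical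
  have h1 := sum_piFinset_range (n := n + 2) (p ^ j) fun d => if hypQ T d = 0 then
    (ZMod.stdAddChar (hypL w l (p ^ k * m₁) d) : ℂ) else 0
  have h2 := sum_split (R := ZMod (p ^ j)) (n := n) fun v x y =>
    if x * y = evalQ T v then (ZMod.stdAddChar ((l : ZMod (p ^ j)) * y +
      (p : ZMod (p ^ j)) ^ k * (m₁ : ZMod (p ^ j)) * x - evalL w v) : ℂ) else 0
  rw [isoSum, ← h2, natIsoSum]
  refine Eq.trans ?_ (h1.trans ?_)
  · refine Finset.sum_congr rfl fun d _ => ?_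
    refine if_congr ?_ ?_ rfl
    · rw [← ZMod.intCast_zmod_eq_zero_iff_dvd, ← hypQ_intCast]
      simp only [Int.cast_natCast]
    · rw [← hypL_intCast]
      simp only [Int.cast_natCast]
  · refine Finset.sum_congr rfl fun d _ => if_congr ?_ ?_ rfl
    · rw [hypQ, sub_eq_zero]
    · rw [hypL]
      push_cast
      rfl

include hp in
lemma aCoef_summand_eq (hsymm : S.IsSymm) {μ : Fin n → ℚ} {w : Fin n → ℤ}
    (hw : ∀ i, (S.map (Int.cast : ℤ → ℚ)).mulVec μ i = w i)
    (l m : ℤ) (j : ℕ) (d : Fin (n + 2) → ℕ) :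
    Complex.exp (2 * Real.pi * Complex.I * ((bilin ℚ (MatS0 n S) (asmVec n l μ m)
      (fun i => (d i : ℚ)) / (p ^ j : ℕ) : ℚ) : ℂ)) =
      ZMod.stdAddChar ((hypL w l m (fun i => (d i : ℤ)) : ℤ) : ZMod (p ^ j)) := by
  have h := hypL_intCast (R := ℚ) w l m (fun i => (d i : ℤ))
  simp only [Int.cast_natCast] at h
  rw [bilin_MatS0 hsymm hw, h, ZMod.stdAddChar_coe]
  congr 1
  push_cast
  ring

lemma exists_quadF_iff (hsymm : S.IsSymm) (heven : ∀ v : Fin n → ℤ, 2 ∣ v ⬝ᵥ S.mulVec v)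
    (d : Fin (n + 2) → ℕ) (γ : ℕ) :
    (∃ e : ℤ, quadF ℚ (MatS0 n S) (fun i => (d i : ℚ)) = (γ : ℚ) * e) ↔
      (γ : ℤ) ∣ hypQ (upper S) (fun i => (d i : ℤ)) := by
  have h := hypQ_intCast (R := ℚ) (upper S) (fun i => (d i : ℤ))
  simp only [Int.cast_natCast] at h
  rw [quadF_MatS0 hsymm heven, h]
  exact exists_congr fun e => by norm_cast

lemma aCoef_one (hsymm : S.IsSymm) (heven : ∀ v : Fin n → ℤ, 2 ∣ v ⬝ᵥ S.mulVec v)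
    {μ : Fin n → ℚ} {w : Fin n → ℤ} (hw : ∀ i, (S.map (Int.cast : ℤ → ℚ)).mulVec μ i = w i)
    (l m : ℤ) : aCoef n S (asmVec n l μ m) (p ^ 0) = natIsoSum p (upper S) w l m 0 := by
  classical
  rw [aCoef, natIsoSum]
  refine Finset.sum_congr rfl fun d _ => ?_
  rw [aCoef_summand_eq hsymm hw]
  refine if_congr ?_ rfl rfl
  rw [exists_quadF_iff hsymm heven]
  refine and_iff_left_of_imp fun ⟨e, he⟩ => ?_
  have := (dvd_ratGcd_gExt hsymm heven (pow_ne_zero 0 hp.out.ne_zero) he _).1 dvd_rfl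
  exact Nat.dvd_one.1 (by exact_mod_cast this.1)

lemma aCoef_succ (hsymm : S.IsSymm) (heven : ∀ v : Fin n → ℤ, 2 ∣ v ⬝ᵥ S.mulVec v)
    (hmax : pMaximal n S p)
    {μ : Fin n → ℚ} {w : Fin n → ℤ} (hw : ∀ i, (S.map (Int.cast : ℤ → ℚ)).mulVec μ i = w i)
    (l m : ℤ) (j : ℕ) : aCoef n S (asmVec n l μ m) (p ^ (j + 1)) =
      natIsoSum p (upper S) w l m (j + 1) - natIsoSum p (upper S) w l m j := by
  classical
  have hp0 : (p : ℤ) ≠ 0 := by exact_mod_cast hp.out.ne_zero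
  have hbad : natIsoSum p (upper S) w l m j =
      ∑ d ∈ Fintype.piFinset fun _ : Fin (n + 2) => Finset.range (p ^ (j + 1)),
        if (∀ i, p ∣ d i) ∧ ((p ^ (j + 2) : ℕ) : ℤ) ∣ hypQ (upper S) (fun i => (d i : ℤ)) then
          (ZMod.stdAddChar ((hypL w l m (fun i => (d i : ℤ)) : ℤ) : ZMod (p ^ (j + 1))) : ℂ)
        else 0 := by
    rw [natIsoSum, ← Finset.sum_filter, ← Finset.sum_filter]
    have hcond : ∀ d : Fin (n + 2) → ℕ,
        ((p ^ (j + 2) : ℕ) : ℤ) ∣ hypQ (upper S) (fun i => ((p * d i : ℕ) : ℤ)) ↔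
          ((p ^ j : ℕ) : ℤ) ∣ hypQ (upper S) (fun i => (d i : ℤ)) := by
      intro d
      push_cast
      rw [hypQ_mul, add_comm, pow_add]
      exact mul_dvd_mul_iff_left (pow_ne_zero _ hp0)
    refine Finset.sum_bij' (fun d _ i => p * d i) (fun d _ i => d i / p) ?_ ?_ ?_ ?_ ?_
    · intro d hd
      simp only [Finset.mem_filter, Fintype.mem_piFinset, Finset.mem_range] at hd ⊢
      refine ⟨fun i => ?_, fun i => dvd_mul_right _ _, (hcond d).2 hd.2⟩
      rw [pow_succ']
      exact Nat.mul_lt_mul_of_pos_left (hd.1 i) hp.out.pos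
    · intro d hd
      simp only [Finset.mem_filter, Fintype.mem_piFinset, Finset.mem_range] at hd ⊢
      refine ⟨fun i => Nat.div_lt_of_lt_mul (by rw [← pow_succ']; exact hd.1 i), ?_⟩
      rw [← hcond]
      simp only [Nat.mul_div_cancel' (hd.2.1 _)]
      exact hd.2.2
    · intro d _
      ext i
      exact Nat.mul_div_cancel_left _ hp.out.pos
    · intro d hd
      ext i
      exact Nat.mul_div_cancel' ((Finset.mem_filter.1 hd).2.1 i)
    · intro d _
      have h := stdAddChar_ppow_mul (p := p) (add_comm 1 j)
        ((hypL w l m (fun i => (d i : ℤ)) : ℤ) : ZMod (p ^ (j + 1)))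
      rw [map_intCast] at h
      rw [← h]
      push_cast
      rw [hypL_mul]
      push_cast
      rw [pow_one]
  rw [hbad, aCoef, natIsoSum, ← Finset.sum_sub_distrib]
  refine Finset.sum_congr rfl fun d _ => ?_
  rw [aCoef_summand_eq hsymm hw, exists_quadF_iff hsymm heven]
  by_cases h : ((p ^ (j + 1) : ℕ) : ℤ) ∣ hypQ (upper S) (fun i => (d i : ℤ))
  · obtain ⟨e, he⟩ := h
    have h2 : ((p ^ (j + 2) : ℕ) : ℤ) ∣ hypQ (upper S) (fun i => (d i : ℤ)) ↔ (p : ℤ) ∣ e := by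
      rw [he]
      push_cast
      rw [pow_succ _ (j + 1)]
      exact mul_dvd_mul_iff_left (pow_ne_zero _ hp0)
    have h1 : ((p ^ (j + 1) : ℕ) : ℤ) ∣ hypQ (upper S) (fun i => (d i : ℤ)) := ⟨e, he⟩
    simp only [ratGcd_gExt_eq_one_iff hsymm heven hmax he, h2, h1, true_and, if_true]
    by_cases h3 : (∀ i, p ∣ d i) ∧ (p : ℤ) ∣ e
    · rw [if_neg (not_not.2 h3), if_pos h3, sub_self]
    · rw [if_pos h3, if_neg h3, sub_zero]
  · have h2 : ¬ ((p ^ (j + 2) : ℕ) : ℤ) ∣ hypQ (upper S) (fun i => (d i : ℤ)) := fun h' =>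
      h (dvd_trans (by push_cast; exact pow_dvd_pow _ (by omega)) h')
    rw [if_neg (fun h' => h h'.1), if_neg h, if_neg (fun h' => h2 h'.2), sub_self]

lemma bCoef_eq (hsymm : S.IsSymm) (heven : ∀ v : Fin n → ℤ, 2 ∣ v ⬝ᵥ S.mulVec v)
    (hmax : pMaximal n S p)
    {μ : Fin n → ℚ} {w : Fin n → ℤ} (hw : ∀ i, (S.map (Int.cast : ℤ → ℚ)).mulVec μ i = w i)
    (l m : ℤ) (j : ℕ) :
    bCoef n S (asmVec n l μ m) (p ^ j) = natIsoSum p (upper S) w l m j := by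
  rw [bCoef, Nat.sum_divisors_prime_pow hp.out, Finset.sum_range_succ', aCoef_one hsymm heven hw]
  simp only [aCoef_succ hsymm heven hmax hw]
  rw [Finset.sum_range_sub]
  ring

lemma Ncount_eq_repCount (hsymm : S.IsSymm) (heven : ∀ v : Fin n → ℤ, 2 ∣ v ⬝ᵥ S.mulVec v)
    {μ : Fin n → ℚ} {w : Fin n → ℤ} (hw : ∀ i, (S.map (Int.cast : ℤ → ℚ)).mulVec μ i = w i)
    (l m₁ : ℤ) {k ν t : ℕ} (htν : t ≤ ν) (htk : t ≤ k) :
    (Ncount n S (asmVec n l μ ((p ^ k * m₁ : ℤ) : ℚ)) p k ν t : ℂ) =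
      repCount p (upper S) w l m₁ k ν t := by
  classical
  have hp0 : (p : ℚ) ≠ 0 := by exact_mod_cast hp.out.ne_zero
  rw [repCount, ← sum_piFinset_range, Ncount, Finset.card_filter, Nat.cast_sum]
  refine Finset.sum_congr rfl fun v _ => ?_
  rw [Nat.cast_ite, Nat.cast_one, Nat.cast_zero]
  have hQ : evalQ (upper S) (fun i => (v i : ℚ)) = (evalQ (upper S) fun i => (v i : ℤ) : ℤ) := by
    rw [← evalQ_intCast]; simp only [Int.cast_natCast]
  have hL : evalL w (fun i => (v i : ℚ)) = (evalL w fun i => (v i : ℤ) : ℤ) := by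
    rw [← evalL_intCast]; simp only [Int.cast_natCast]
  refine if_congr (and_congr ?_ ?_) rfl rfl
  · have h : evalQ (upper S) (fun i => (v i : ZMod (p ^ ν))) =
        (evalQ (upper S) fun i => (v i : ℤ) : ℤ) := by
      rw [← evalQ_intCast]; simp only [Int.cast_natCast]
    rw [h, ppow_mul_intCast_eq_zero (Nat.sub_add_cancel htν), quadF_eq hsymm heven, hQ]
    exact exists_congr fun e => by norm_cast
  · have h : inhom p (upper S) w l m₁ k t (fun i => (v i : ZMod (p ^ ν))) =
        (inhom p (upper S) w l m₁ k t fun i => (v i : ℤ) : ℤ) := by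
      have := map_inhom (p := p) (T := upper S) (w := w) (l := l) (m₁ := m₁) (k := k) t
        (Int.castRingHom (ZMod (p ^ ν))) fun i => (v i : ℤ)
      simp only [eq_intCast, Int.cast_natCast] at this
      exact this.symm
    have e1 : (p : ℚ) ^ ((k : ℤ) - (t : ℤ)) = (p : ℚ) ^ (k - t) := by
      rw [← Nat.cast_sub htk, zpow_natCast]
    have e2 : (p : ℚ) ^ ((t : ℤ) - (k : ℤ)) * l * ((p ^ k * m₁ : ℤ) : ℚ) = p ^ t * l * m₁ := by
      rw [zpow_sub₀ hp0, zpow_natCast, zpow_natCast]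
      push_cast
      field_simp
    have e3 : asmVec n (l : ℚ) μ ((p ^ k * m₁ : ℤ) : ℚ) ⟨0, by omega⟩ = l := by simp [asmVec]
    have e4 : asmVec n (l : ℚ) μ ((p ^ k * m₁ : ℤ) : ℚ) ⟨n + 1, by omega⟩ =
      ((p ^ k * m₁ : ℤ) : ℚ) := by simp [asmVec]
    rw [h, ZMod.intCast_zmod_eq_zero_iff_dvd, vmid_asmVec, bilin_dual hw, quadF_eq hsymm heven,
      hQ, hL, e1, e3, e4, e2]
    refine exists_congr fun e => ?_
    rw [inhom]
    push_cast
    norm_cast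

end coefficients

end PrimePowerSums

/-- `Σ_{j≤ν} p^{(ν−j)n} b(λ,p^j) = p^ν N*(λ,p^ν)`
(the coefficients of `ζ(s−n)·L(s,b(λ,·))`). -/
theorem zeta_convolution_eq_representation_numbers
    (n : ℕ) (hn : 1 ≤ n) (S : Matrix (Fin n) (Fin n) ℤ)
    (hsymm : S.IsSymm)
    (hpos : ∀ v : Fin n → ℝ, v ≠ 0 → 0 < bilin ℝ S v v)
    (heven : ∀ v : Fin n → ℤ, 2 ∣ v ⬝ᵥ S.mulVec v)
    (p : ℕ) (hp : p.Prime) (hmax : pMaximal n S p)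
    (l : ℤ) (μ : Fin n → ℚ) (hμ : inDual S μ) (m : ℤ)
    (lam : Fin (n + 2) → ℚ) (hlamdef : lam = asmVec n (l : ℚ) μ (m : ℚ))
    (hlampos : (fun i => ((lam i : ℚ) : ℝ)) ∈ PosCone n S)
    (νl : ℕ)
    (hνl : νl = padicValNat p
      (ratGcd (((MatS0 n S).map (Int.cast : ℤ → ℚ)).mulVec lam)))
    (hνlm : νl = padicValInt p m)
    (ν : ℕ) :
    ∑ j ∈ Finset.range (ν + 1),
        ((p : ℂ)) ^ ((ν - j) * n) * bCoef n S lam (p ^ j)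
      = ((p : ℂ)) ^ ν * (Nstar n S lam p νl ν : ℂ) := by
  have hF : Fact p.Prime := ⟨hp⟩
  choose w hw using hμ
  subst hlamdef
  have hm : m ≠ 0 := by
    rintro rfl
    refine absurd hlampos.1 (not_lt.2 ?_)
    have h0 : ∀ u : Fin n → ℝ, 0 ≤ bilin ℝ S u u := fun u => by
      rcases eq_or_ne u 0 with rfl | hu
      · simp [bilin]
      · exact (hpos u hu).le
    have hlast : vlast (fun i => ((asmVec n (l : ℚ) μ ((0 : ℤ) : ℚ) i : ℚ) : ℝ)) = 0 := by
      simp [vlast, asmVec]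
    rw [quadF, MatS0, PrimePowerSums.bilin_hyp, PrimePowerSums.bilin_neg,
      hlast]
    rw [mul_zero, zero_mul, add_zero, zero_add]
    exact div_nonpos_of_nonpos_of_nonneg (neg_nonpos.2 (h0 _)) zero_le_two
  obtain ⟨m₁, rfl⟩ : (p : ℤ) ^ νl ∣ m := by
    rw [hνlm]; exact (padicValInt_dvd_iff _ m).2 (Or.inr le_rfl)
  have hm₁ : ¬ (p : ℤ) ∣ m₁ := by
    rintro ⟨z, rfl⟩
    have h : (p : ℤ) ^ (νl + 1) ∣ (p : ℤ) ^ νl * (p * z) := ⟨z, by ring⟩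
    rcases (padicValInt_dvd_iff _ _).1 h with h | h
    · exact hm h
    · omega
  have hwd : ∀ i, (p : ℤ) ^ νl ∣ w i := by
    intro i
    have h : p ^ νl ∣ ratGcd (((MatS0 n S).map (Int.cast : ℤ → ℚ)).mulVec
        (asmVec n (l : ℚ) μ ((p ^ νl * m₁ : ℤ) : ℚ))) := by
      nth_rewrite 1 [hνl]
      exact pow_padicValNat_dvd
    have := PrimePowerSums.dvd_ratGcd.1 h ⟨i + 1, by omega⟩
    rw [MatS0, PrimePowerSums.hyp_mulVec_mid, PrimePowerSums.vmid_asmVec] at this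
    have e : ((-S).map (Int.cast : ℤ → ℚ)).mulVec μ i = ((-w i : ℤ) : ℚ) := by
      rw [Int.cast_neg, ← hw i]
      simp [Matrix.mulVec, dotProduct]
    rw [e, Rat.num_intCast, dvd_neg] at this
    exact_mod_cast this
  simp only [PrimePowerSums.bCoef_eq hsymm heven hmax hw,
    PrimePowerSums.natIsoSum_eq_isoSum]
  rw [PrimePowerSums.sum_isoSum_eq hwd hm₁, Nstar, Nat.cast_sum]
  congr 1
  refine Finset.sum_congr rfl fun t ht => ?_
  have ht' := Finset.mem_range.1 ht
  exact (PrimePowerSums.Ncount_eq_repCount hsymm heven hw l m₁ (by omega) (by omega)).symm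
end

section
/- Let p be a prime such that S is p-maximal, and let λ = (l,μ,m) ∈ L₀^# ∩ P_S with ν_λ := ν_p(gcd(S₀λ)) = ν_p(m). Let ℓ_λ be the level of λ and r := ν_p(ℓ_λ). Then for every integer ν ≥ 0, with t* := min(ν,ν_λ): N(λ, p^ν, p^{t*}) = #{v ∈ (ℤ/p^{ν+r}ℤ)ⁿ : v ≡ −p^r·μ (mod p^r) and Q(v) ≡ −Q₀(p^r·λ) (mod p^{ν+2r})}, where p^r·μ has p-integral entries and Q₀(p^r·λ) = p^{2r}·Q₀(λ) is p-integral, so both congruences are meaningful after reduction modulo the indicated p-powers. -/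
open Matrix Complex

open OEis

namespace OEis

/-- Congruence to zero modulo `p ^ M` can be tested after clearing a denominator prime to `p`. -/
theorem pCong_iff_dvd {p : ℕ} (hp : p.Prime) {k : ℤ} (hk : ¬ (p : ℤ) ∣ k) (M : ℕ)
    {q : ℚ} {z : ℤ} (h : (k : ℚ) * q = z) : pCong p M q ↔ (p : ℤ) ^ M ∣ z := by
  have := Fact.mk hp
  have hk0 : (k : ℚ) ≠ 0 := by
    rintro h0
    apply hk
    simp [Int.cast_eq_zero.mp h0]
  unfold pCong
  by_cases hq : q = 0
  · have hz : z = 0 := by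
      rw [hq, mul_zero] at h
      exact_mod_cast h.symm
    simp [hq, hz]
  · have hz : z ≠ 0 := by
      rintro rfl
      simp_all
    have hv : padicValRat p q = padicValInt p z := by
      rw [← padicValRat.of_int, ← h, padicValRat.mul hk0 hq, padicValRat.of_int,
        padicValInt.eq_zero_of_not_dvd hk]
      simp
    rw [padicValInt_dvd_iff, hv]
    simp [hq, hz]

/-- Reduction modulo `N` after dividing the coset `-a + Pℤ^ι` by `P`. -/
theorem card_filter_coset_eq {ι : Type*} [Fintype ι] [DecidableEq ι] {N P : ℕ} (hN : 0 < N)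
    (hP : 0 < P) (a : ι → ℤ) (F : (ι → ℤ) → Prop)
    (hF : ∀ u c : ι → ℤ, F u → F (fun i => u i + N * c i))
    (A B : (ι → ℕ) → Prop) [DecidablePred A] [DecidablePred B]
    (hA : ∀ w, A w ↔ F (fun i => (w i : ℤ)))
    (hB : ∀ v, B v ↔ ∃ u : ι → ℤ, (∀ i, (v i : ℤ) + a i = P * u i) ∧ F u) :
    ((Fintype.piFinset fun _ : ι => Finset.range N).filter A).card =
      ((Fintype.piFinset fun _ : ι => Finset.range (N * P)).filter B).card := by
  have hNZ : (0 : ℤ) < N := by exact_mod_cast hN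
  have hPZ : (0 : ℤ) < P := by exact_mod_cast hP
  have hNP : (0 : ℤ) < N * P := mul_pos hNZ hPZ
  have forward (w : ι → ℕ) (i : ι) :
      ((((P * w i - a i : ℤ) % (N * P)).toNat : ℕ) : ℤ) = (P * w i - a i) % (N * P) :=
    Int.toNat_of_nonneg (Int.emod_nonneg _ hNP.ne')
  have backward (v : ι → ℕ) (i : ι) :
      ((((v i + a i : ℤ) / P % N).toNat : ℕ) : ℤ) = (v i + a i) / P % N :=
    Int.toNat_of_nonneg (Int.emod_nonneg _ hNZ.ne')
  refine Finset.card_bij'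
    (fun w _ i => ((P * w i - a i : ℤ) % (N * P)).toNat)
    (fun v _ i => ((v i + a i : ℤ) / P % N).toNat) ?_ ?_ ?_ ?_
  · intro w hw
    simp only [Finset.mem_filter, Fintype.mem_piFinset, Finset.mem_range] at hw ⊢
    refine ⟨fun i => ?_, ?_⟩
    · zify
      rw [forward]
      exact Int.emod_lt_of_pos _ hNP
    · refine (hB _).2
        ⟨fun i => w i + N * (-((P * w i - a i) / (N * P))), fun i => ?_,
          hF _ _ ((hA w).1 hw.2)⟩
      rw [forward, Int.emod_def]
      ring
  · intro v hv
    simp only [Finset.mem_filter, Fintype.mem_piFinset, Finset.mem_range] at hv ⊢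
    obtain ⟨u, hu, hFu⟩ := (hB v).1 hv.2
    refine ⟨fun i => ?_, (hA _).2 ?_⟩
    · zify
      rw [backward]
      exact Int.emod_lt_of_pos _ hNZ
    · convert hF u (fun i => -(u i / N)) hFu using 2 with i
      rw [backward, hu, Int.mul_ediv_cancel_left _ hPZ.ne', Int.emod_def]
      ring
  · intro w hw
    simp only [Finset.mem_filter, Fintype.mem_piFinset, Finset.mem_range] at hw
    funext i
    zify
    rw [backward (fun i => ((P * w i - a i : ℤ) % (N * P)).toNat), forward,
      Int.emod_def (P * w i - a i)]
    have : (P * w i - a i - N * P * ((P * w i - a i) / (N * P)) + a i : ℤ)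
        = P * (w i + N * (-((P * w i - a i) / (N * P)))) := by ring
    rw [this, Int.mul_ediv_cancel_left _ hPZ.ne', Int.add_mul_emod_self_left]
    exact Int.emod_eq_of_lt (by positivity) (by exact_mod_cast hw.1 i)
  · intro v hv
    simp only [Finset.mem_filter, Fintype.mem_piFinset, Finset.mem_range] at hv
    obtain ⟨u, hu, -⟩ := (hB v).1 hv.2
    funext i
    zify
    rw [forward (fun i => ((v i + a i : ℤ) / P % N).toNat), backward, hu,
      Int.mul_ediv_cancel_left _ hPZ.ne', Int.emod_def (u i)]
    have : (P * (u i - N * (u i / N)) - a i : ℤ) = v i + N * P * (-(u i / N)) := by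
      linear_combination -hu i
    rw [this, Int.add_mul_emod_self_left]
    exact Int.emod_eq_of_lt (by positivity) (by exact_mod_cast hv.1 i)

/-- The two defining congruences of the top representation number collapse to one. -/
theorem top_congruences_iff {p : ℕ} (hp : p ≠ 0) (νl ν : ℕ) {q A l m : ℤ}
    (hA : (p : ℤ) ^ νl ∣ A) (hl : (p : ℤ) ^ νl ∣ l) :
    ((∃ e : ℤ, (q : ℚ) = (p : ℚ) ^ min ν νl * e) ∧
      ∃ e : ℤ, (p : ℚ) ^ ((νl : ℤ) - (min ν νl : ℕ)) * q - A
        + (p : ℚ) ^ (((min ν νl : ℕ) : ℤ) - νl) * l * m = (p : ℚ) ^ ν * e) ↔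
      (p : ℤ) ^ ν ∣ q - A + l * m := by
  have hp0 : (p : ℚ) ≠ 0 := by exact_mod_cast hp
  obtain ⟨A, rfl⟩ := hA
  obtain ⟨l, rfl⟩ := hl
  rcases le_total ν νl with h | h
  · obtain ⟨d, rfl⟩ := Nat.exists_eq_add_of_le h
    rw [min_eq_left h]
    have h1 : (((ν + d : ℕ) : ℤ) - (ν : ℕ)) = (d : ℕ) := by push_cast; ring
    have h2 : ((ν : ℤ) - ((ν + d : ℕ) : ℤ)) = -(d : ℕ) := by push_cast; ring
    rw [h1, h2, _root_.zpow_neg, zpow_natCast]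
    have hd : (p : ℚ) ^ d ≠ 0 := pow_ne_zero _ hp0
    constructor
    · rintro ⟨⟨e, he⟩, -⟩
      have he' : q = (p : ℤ) ^ ν * e := by exact_mod_cast he
      exact ⟨e - p ^ d * A + p ^ d * l * m, by rw [he']; ring⟩
    · rintro ⟨e, he⟩
      have hq : q = (p : ℤ) ^ ν * (e + p ^ d * A - p ^ d * l * m) := by
        linear_combination he
      refine ⟨⟨_, by rw [hq]; exact_mod_cast rfl⟩,
        ⟨p ^ d * (e + p ^ d * A - p ^ d * l * m) - p ^ d * A + l * m, ?_⟩⟩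
      rw [hq]
      push_cast
      rw [pow_add]
      field_simp
  · rw [min_eq_right h, sub_self, zpow_zero, one_mul, one_mul]
    obtain ⟨d, rfl⟩ := Nat.exists_eq_add_of_le h
    constructor
    · rintro ⟨-, e, he⟩
      exact ⟨e, by exact_mod_cast he⟩
    · rintro ⟨e, he⟩
      refine ⟨⟨p ^ d * e + A - l * m, ?_⟩, e, by exact_mod_cast he⟩
      have : q = (p : ℤ) ^ νl * (p ^ d * e + A - l * m) := by
        linear_combination he
      exact_mod_cast this

section Hyperbolic

variable {n : ℕ} (S : Matrix (Fin n) (Fin n) ℤ) (l m : ℚ) (μ : Fin n → ℚ)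

theorem vmid_asmVec : vmid (asmVec n l μ m) = μ := by
  funext i
  have := i.isLt
  simp [vmid, asmVec, this.ne]

theorem MatS0_mulVec_asmVec_zero :
    ((MatS0 n S).map (Int.cast : ℤ → ℚ)).mulVec (asmVec n l μ m) 0 = m := by
  have h (j : Fin n) := j.isLt.ne
  rw [Matrix.mulVec, dotProduct, Fin.sum_univ_succ, Fin.sum_univ_castSucc]
  simp [MatS0, hyp, asmVec, h]

theorem MatS0_mulVec_asmVec_last :
    ((MatS0 n S).map (Int.cast : ℤ → ℚ)).mulVec (asmVec n l μ m) (Fin.last (n + 1)) = l := by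
  simp [Matrix.mulVec, dotProduct, Fin.sum_univ_succ, MatS0, hyp, asmVec]

theorem MatS0_mulVec_asmVec_mid (i : Fin n) :
    ((MatS0 n S).map (Int.cast : ℤ → ℚ)).mulVec (asmVec n l μ m) i.castSucc.succ
      = -(S.map (Int.cast : ℤ → ℚ)).mulVec μ i := by
  have hi := i.isLt.ne
  have h (j : Fin n) := j.isLt.ne
  rw [Matrix.mulVec, dotProduct, Fin.sum_univ_succ, Fin.sum_univ_castSucc]
  simp [Matrix.mulVec, dotProduct, MatS0, hyp, asmVec, hi, h]

theorem quadF_MatS0_asmVec :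
    quadF ℚ (MatS0 n S) (asmVec n l μ m) = l * m - quadF ℚ S μ := by
  have h (j : Fin n) := j.isLt.ne
  rw [quadF, bilin, dotProduct, Fin.sum_univ_succ, Fin.sum_univ_castSucc,
    MatS0_mulVec_asmVec_zero, Fin.succ_last, MatS0_mulVec_asmVec_last]
  simp only [MatS0_mulVec_asmVec_mid]
  simp [asmVec, h, quadF, bilin, dotProduct]
  ring

end Hyperbolic

theorem ordv_spec {k : ℕ} (v : Fin k → ℚ) :
    0 < ordv v ∧ ∀ i, ∃ z : ℤ, (ordv v : ℚ) * v i = z := by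
  refine Nat.sInf_mem (s := {N : ℕ | 0 < N ∧ ∀ i, ∃ z : ℤ, (N : ℚ) * v i = (z : ℚ)})
    ⟨∏ i, (v i).den, Finset.prod_pos fun i _ => (v i).pos, fun i => ?_⟩
  obtain ⟨c, hc⟩ := Finset.dvd_prod_of_mem (fun i => (v i).den) (Finset.mem_univ i)
  refine ⟨c * (v i).num, ?_⟩
  rw [hc]
  push_cast
  linear_combination (c : ℚ) * Rat.mul_den_eq_num (v i)

end OEis

open scoped Classical in
/-- Bruinier-type formula for the top representation number
`N(λ, p^ν, p^{t*})`, `t* = min(ν,ν_λ)`. -/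
theorem representation_number_top_term
    (n : ℕ) (hn : 1 ≤ n) (S : Matrix (Fin n) (Fin n) ℤ)
    (hsymm : S.IsSymm)
    (hpos : ∀ v : Fin n → ℝ, v ≠ 0 → 0 < bilin ℝ S v v)
    (heven : ∀ v : Fin n → ℤ, 2 ∣ v ⬝ᵥ S.mulVec v)
    (p : ℕ) (hp : p.Prime) (hmax : pMaximal n S p)
    (l : ℤ) (μ : Fin n → ℚ) (hμ : inDual S μ) (m : ℤ)
    (lam : Fin (n + 2) → ℚ) (hlamdef : lam = asmVec n (l : ℚ) μ (m : ℚ))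
    (hlampos : (fun i => ((lam i : ℚ) : ℝ)) ∈ PosCone n S)
    (νl : ℕ)
    (hνl : νl = padicValNat p
      (ratGcd (((MatS0 n S).map (Int.cast : ℤ → ℚ)).mulVec lam)))
    (hνlm : νl = padicValInt p m)
    (r : ℕ) (hr : r = padicValNat p (ordv lam))
    (ν : ℕ) :
    Ncount n S lam p νl ν (min ν νl)
      = ((Fintype.piFinset fun _ : Fin n => Finset.range (p ^ (ν + r))).filter
          fun v =>
            (∀ i, pCong p r ((v i : ℚ) + (p : ℚ) ^ r * μ i)) ∧
            pCong p (ν + 2 * r)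
              (quadF ℚ S (fun i => (v i : ℚ)) +
                (p : ℚ) ^ (2 * r) * quadF ℚ (MatS0 n S) lam)).card := by
  have := Fact.mk hp
  subst hlamdef
  have hp0 : p ≠ 0 := hp.ne_zero
  choose s hs using hμ
  choose q hq using heven
  have hsm : (S.map (Int.cast : ℤ → ℚ)).mulVec μ = fun i => (s i : ℚ) := funext hs
  have cast_mulVec (v : Fin n → ℤ) :
      (S.map (Int.cast : ℤ → ℚ)).mulVec (fun i => (v i : ℚ)) =
        fun i => ((S.mulVec v i : ℤ) : ℚ) := by
    funext i
    simp [Matrix.mulVec, dotProduct]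
  have hqQ (v : Fin n → ℤ) : quadF ℚ S (fun i => (v i : ℚ)) = q v := by
    rw [quadF, bilin, cast_mulVec]
    have : ((v ⬝ᵥ S.mulVec v : ℤ) : ℚ) = 2 * q v := by rw [hq]; push_cast; rfl
    simp only [dotProduct] at this ⊢
    push_cast at this
    rw [this]
    ring
  have symm_dot (u v : Fin n → ℤ) : u ⬝ᵥ S.mulVec v = v ⬝ᵥ S.mulVec u := by
    rw [Matrix.dotProduct_mulVec, ← Matrix.mulVec_transpose, hsymm.eq, dotProduct_comm]
  have q_add (u v : Fin n → ℤ) : q (u + v) = q u + q v + u ⬝ᵥ S.mulVec v := by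
    have h1 := hq (u + v)
    have h2 := hq u
    have h3 := hq v
    rw [Matrix.mulVec_add, add_dotProduct, dotProduct_add, dotProduct_add, h2, h3,
      symm_dot v u] at h1
    linarith
  have q_smul (c : ℤ) (u : Fin n → ℤ) : q (c • u) = c ^ 2 * q u := by
    have h1 := hq (c • u)
    have h2 := hq u
    rw [Matrix.mulVec_smul, smul_dotProduct, dotProduct_smul, h2] at h1
    simp only [smul_eq_mul] at h1
    linarith
  have hdvd (i : Fin (n + 2)) : p ^ νl ∣ ((((MatS0 n S).map (Int.cast : ℤ → ℚ)).mulVec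
      (asmVec n l μ m)) i).num.natAbs := by
    rw [hνl]
    exact pow_padicValNat_dvd.trans (Finset.gcd_dvd (Finset.mem_univ i))
  have hl : (p : ℤ) ^ νl ∣ l := by
    have h := hdvd (Fin.last (n + 1))
    rw [MatS0_mulVec_asmVec_last] at h
    simpa using Int.natCast_dvd.mpr h
  have hsd (i : Fin n) : (p : ℤ) ^ νl ∣ s i := by
    have h := hdvd i.castSucc.succ
    rw [MatS0_mulVec_asmVec_mid, hs] at h
    simpa using Int.natCast_dvd.mpr h
  obtain ⟨hN0, hN⟩ := ordv_spec (asmVec n (l : ℚ) μ (m : ℚ))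
  have hNμ (i : Fin n) :
      ∃ z : ℤ, (ordv (asmVec n (l : ℚ) μ (m : ℚ)) : ℚ) * μ i = z := by
    have h := hN i.castSucc.succ
    have hi := i.isLt.ne
    simpa [asmVec, hi] using h
  choose b hb using hNμ
  obtain ⟨k, hk⟩ : p ^ r ∣ ordv (asmVec n (l : ℚ) μ (m : ℚ)) := hr ▸ pow_padicValNat_dvd
  have hpk : ¬ p ∣ k := by
    rintro ⟨j, rfl⟩
    have : p ^ (r + 1) ∣ ordv (asmVec n (l : ℚ) μ (m : ℚ)) :=
      ⟨j, by rw [hk]; ring⟩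
    rw [hr] at this
    exact pow_succ_padicValNat_not_dvd hN0.ne' this
  rw [hk] at hb
  have hpkZ : ¬ (p : ℤ) ∣ (k : ℤ) := by exact_mod_cast hpk
  have hpkZ2 : ¬ (p : ℤ) ∣ (k : ℤ) ^ 2 := fun h =>
    hpkZ ((Nat.prime_iff_prime_int.mp hp).dvd_of_dvd_pow h)
  have hcop (M : ℕ) : IsCoprime ((p : ℤ) ^ M) (k : ℤ) := by
    exact IsCoprime.pow_left
      (Nat.isCoprime_iff_coprime.mpr ((Nat.Prime.coprime_iff_not_dvd hp).mpr hpk))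
  obtain ⟨x, k', hk'⟩ := hcop (ν + 2 * r)
  have hbμ : (fun i => (b i : ℚ)) = ((p ^ r * k : ℕ) : ℚ) • μ := by
    funext i
    simp [← hb i]
  have hqb : (q b : ℚ) = (k : ℚ) ^ 2 * ((p : ℚ) ^ (2 * r) * quadF ℚ S μ) := by
    rw [← hqQ, hbμ, quadF, quadF, bilin, bilin, Matrix.mulVec_smul, smul_dotProduct,
      dotProduct_smul]
    simp only [smul_eq_mul]
    push_cast
    ring
  have hSb : S.mulVec b = ((p : ℤ) ^ r * k) • s := by
    have h := cast_mulVec b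
    rw [hbμ, Matrix.mulVec_smul, hsm] at h
    funext i
    have := congrFun h i
    simp only [Pi.smul_apply, smul_eq_mul] at this ⊢
    exact_mod_cast this.symm
  let F : (Fin n → ℤ) → ℤ := fun w => q w - w ⬝ᵥ s + l * m
  have key (v u : Fin n → ℤ) (hvu : ∀ i, v i + k' * b i = (p : ℤ) ^ r * u i) :
      (p : ℤ) ^ (ν + 2 * r) ∣ k ^ 2 * q v + k ^ 2 * p ^ (2 * r) * (l * m) - q b ↔
        (p : ℤ) ^ ν ∣ F u := by
    have hv : v = ((p : ℤ) ^ r) • u + (-k') • b := by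
      funext i
      simp only [Pi.add_apply, Pi.smul_apply, smul_eq_mul]
      linear_combination hvu i
    have hqv : q v = p ^ (2 * r) * q u + k' ^ 2 * q b - p ^ (2 * r) * k' * k * (u ⬝ᵥ s) := by
      rw [hv, q_add, q_smul, q_smul, Matrix.mulVec_smul, hSb, smul_dotProduct,
        dotProduct_smul, dotProduct_smul]
      simp only [smul_eq_mul]
      ring
    have hsplit : k ^ 2 * q v + k ^ 2 * p ^ (2 * r) * (l * m) - q b =
        p ^ (2 * r) * (k ^ 2 * F u) + (p : ℤ) ^ (ν + 2 * r) *
          (k ^ 2 * p ^ (2 * r) * x * (u ⬝ᵥ s) - x * (k' * k + 1) * q b) := by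
      have e : (p : ℤ) ^ (ν + 2 * r) * x = 1 - k' * k := by linear_combination hk'
      simp only [F]
      rw [hqv]
      linear_combination (-(k ^ 2 * p ^ (2 * r) * (u ⬝ᵥ s)) + (k' * k + 1) * q b : ℤ) * e
    rw [hsplit, Int.dvd_add_left (Dvd.intro _ rfl), pow_add, mul_comm ((p : ℤ) ^ ν),
      mul_dvd_mul_iff_left (pow_ne_zero _ (by exact_mod_cast hp0))]
    exact ⟨((hcop ν).pow_right).dvd_of_dvd_mul_left, fun h => h.mul_left _⟩
  rw [pow_add, Ncount]
  refine card_filter_coset_eq (pow_pos hp.pos ν) (pow_pos hp.pos r) (fun i => k' * b i)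
    (fun w => (p : ℤ) ^ ν ∣ F w) ?_ _ _ ?_ ?_
  · intro u c hu
    have hF : F (fun i => u i + ((p ^ ν : ℕ) : ℤ) * c i) =
        F u + (p : ℤ) ^ ν * (p ^ ν * q c + u ⬝ᵥ S.mulVec c - c ⬝ᵥ s) := by
      have : (fun i => u i + ((p ^ ν : ℕ) : ℤ) * c i) = u + ((p : ℤ) ^ ν) • c := by
        funext i
        simp
      simp only [F]
      rw [this, q_add, q_smul, Matrix.mulVec_smul, dotProduct_smul, add_dotProduct,
        smul_dotProduct]
      simp only [smul_eq_mul]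
      ring
    rw [hF]
    exact dvd_add hu (Dvd.intro _ rfl)
  · intro w
    have h1 : quadF ℚ S (fun i => (w i : ℚ)) = q (fun i => (w i : ℤ)) := by
      rw [← hqQ]
      simp
    have h2 : bilin ℚ S (fun i => (w i : ℚ)) μ = ((fun i => (w i : ℤ)) ⬝ᵥ s : ℤ) := by
      rw [bilin, hsm]
      simp [dotProduct]
    have h3 : asmVec n (l : ℚ) μ (m : ℚ) ⟨0, by omega⟩ = l := by simp [asmVec]
    have h4 : asmVec n (l : ℚ) μ (m : ℚ) ⟨n + 1, by omega⟩ = m := by simp [asmVec]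
    rw [h1, vmid_asmVec, h2, h3, h4]
    exact top_congruences_iff hp0 νl ν
      (Finset.dvd_sum fun i _ => (hsd i).mul_left _) hl
  · intro v
    have hlin (i : Fin n) : pCong p r ((v i : ℚ) + (p : ℚ) ^ r * μ i) ↔
        (p : ℤ) ^ r ∣ v i + k' * b i := by
      rw [pCong_iff_dvd hp hpkZ r (z := k * v i + b i)
        (by push_cast; rw [← hb i]; push_cast; ring)]
      have : (k * (v i + k' * b i) : ℤ) =
          (k * v i + b i) + p ^ r * (-(p ^ (ν + r) * x * b i)) := by
        have e : (p : ℤ) ^ r * (p ^ (ν + r) * x) = 1 - k' * k := by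
          rw [← hk']
          ring
        linear_combination (b i) * e
      rw [← Int.dvd_add_left (Dvd.intro _ rfl : (p : ℤ) ^ r ∣ p ^ r * _), ← this]
      exact ⟨(hcop r).dvd_of_dvd_mul_left, fun h => h.mul_left _⟩
    have hquad : pCong p (ν + 2 * r) (quadF ℚ S (fun i => (v i : ℚ)) +
        (p : ℚ) ^ (2 * r) * quadF ℚ (MatS0 n S) (asmVec n (l : ℚ) μ (m : ℚ))) ↔
        (p : ℤ) ^ (ν + 2 * r) ∣
          k ^ 2 * q (fun i => (v i : ℤ)) + k ^ 2 * p ^ (2 * r) * (l * m) - q b := by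
      refine pCong_iff_dvd hp hpkZ2 _ ?_
      have h1 : quadF ℚ S (fun i => (v i : ℚ)) = q (fun i => (v i : ℤ)) := by
        rw [← hqQ]
        simp
      rw [h1, quadF_MatS0_asmVec]
      push_cast
      rw [hqb]
      ring
    rw [hquad]
    simp only [hlin]
    constructor
    · rintro ⟨h1, h2⟩
      choose u hu using h1
      exact ⟨u, by exact_mod_cast hu, (key _ u hu).1 h2⟩
    · rintro ⟨u, hu, hFu⟩
      have hu' : ∀ i, (v i : ℤ) + k' * b i = (p : ℤ) ^ r * u i := by exact_mod_cast hu
      exact ⟨fun i => ⟨u i, hu' i⟩, (key _ u hu').2 hFu⟩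
end
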